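/- arXiv:2501.13680 — 4 statements merged into one kernel-verified Lean document; each statement's English description precedes it below -/
import Mathlib

section
/- Let K be a field of characteristic zero and g_1, ..., g_n ∈ K[x_1, ..., x_n] with d := deg g_1 > 0 and D := max_{2 ≤ i ≤ n} deg g_i > 0. Let f_min be the minimal polynomial of I_g ∩ K[x_1^{(∞)}] and let ν be a positive integer with ord f_min ≤ ν. Then for every vector (ω_1, ..., ω_ν) ∈ (ℤ_{≥0})^ν and every monomial x_1^{e_0}(x_1')^{e_1}⋯(x_1^{(ν)})^{e_ν} appearing with nonzero coefficient in f_min, the inequality e_0 + Σ_{i=1}^{ν} ω_i e_i ≤ Π_{k=1}^{ν} max( ω_k, d + (k−1)(D−1), max_{1 ≤ j < k} ( d + ((k−1)/j)(ω_j − 1) ) ) holds. -/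
open MvPolynomial

noncomputable section

/-- The canonical derivation on the ring of differential polynomials
`K[x_i^{(j)} : 1 ≤ i ≤ n, j ≥ 0]`, sending `x_i^{(j)}` to `x_i^{(j+1)}`. -/
def diffDer (K : Type*) [CommRing K] (n : ℕ) :
    Derivation K (MvPolynomial (Fin n × ℕ) K) (MvPolynomial (Fin n × ℕ) K) :=
  MvPolynomial.mkDerivation K fun v => X (v.1, v.2 + 1)

/-- The differential ideal generated by a set `S`: the ideal generated by all
derivatives of elements of `S`. -/
def diffIdeal (K : Type*) [CommRing K] (n : ℕ) (S : Set (MvPolynomial (Fin n × ℕ) K)) :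
    Ideal (MvPolynomial (Fin n × ℕ) K) :=
  Ideal.span {q | ∃ f ∈ S, ∃ j : ℕ, q = (⇑(diffDer K n))^[j] f}

/-- The differential ideal `I_g = ⟨x_1' - g_1, …, x_n' - g_n⟩^(∞)` of the
system `x' = g(x)`. -/
def sysIdeal (K : Type*) [CommRing K] (n : ℕ) (g : Fin n → MvPolynomial (Fin n) K) :
    Ideal (MvPolynomial (Fin n × ℕ) K) :=
  diffIdeal K n (Set.range fun i => X (i, 1) - rename (fun j => (j, 0)) (g i))

/-- The order of a differential polynomial: the largest `j` such that some variable
`x_i^{(j)}` appears. -/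
def ordOf {K : Type*} [CommSemiring K] {n : ℕ} (f : MvPolynomial (Fin n × ℕ) K) : ℕ :=
  f.vars.sup Prod.snd

/-- `f` is a minimal polynomial of the elimination ideal `I ∩ K[x_1^{(∞)}]`:
a nonzero element of `I` involving only the variables `x_1^{(j)}`, of minimal order and
then minimal total degree among all such elements. -/
def IsMinPoly (K : Type*) [Field K] (n : ℕ) [NeZero n]
    (I : Ideal (MvPolynomial (Fin n × ℕ) K)) (f : MvPolynomial (Fin n × ℕ) K) : Prop :=
  f ≠ 0 ∧ f ∈ I ∧ (∀ v ∈ f.vars, v.1 = (0 : Fin n)) ∧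
    ∀ h : MvPolynomial (Fin n × ℕ) K, h ≠ 0 → h ∈ I → (∀ v ∈ h.vars, v.1 = (0 : Fin n)) →
      ordOf f ≤ ordOf h ∧ (ordOf h ≤ ordOf f → f.totalDegree ≤ h.totalDegree)

section Counting

/-- A linearly independent family of polynomials has an injective choice of monomials, one in
the support of each member. -/
theorem LinearIndependent.exists_injective_mem_support {K V I : Type*} [Field K]
    {v : I → MvPolynomial V K} (hv : LinearIndependent K v) :
    ∃ φ : I → (V →₀ ℕ), Function.Injective φ ∧ ∀ i, φ i ∈ (v i).support := by
  classical
  refine (Finset.all_card_le_biUnion_card_iff_exists_injective fun i => (v i).support).1 fun s => ?_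
  set T : Finset (V →₀ ℕ) := s.biUnion fun i => (v i).support with hT
  let b := basisRestrictSupport K (T : Set (V →₀ ℕ))
  have : Module.Finite K (restrictSupport K (T : Set (V →₀ ℕ))) := Module.Finite.of_basis b
  have hmem : ∀ i : s, v i ∈ restrictSupport K (T : Set (V →₀ ℕ)) := fun i => by
    rw [mem_restrictSupport_iff]
    exact_mod_cast Finset.subset_biUnion_of_mem (fun i => (v i).support) i.2
  have hli : LinearIndependent K
      (fun i : s => (⟨v i, hmem i⟩ : restrictSupport K (T : Set (V →₀ ℕ)))) :=
    LinearIndependent.of_comp (Submodule.subtype _) (hv.comp _ Subtype.val_injective)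
  have h := hli.fintype_card_le_finrank
  rw [Module.finrank_eq_card_basis b] at h
  simpa using h

theorem ENNReal.tsum_fin_pi_prod : ∀ {n : ℕ} (f : Fin n → ℕ → ENNReal),
    ∑' m : Fin n → ℕ, ∏ i, f i (m i) = ∏ i, ∑' k, f i k
  | 0, f => by simp
  | n + 1, f => by
    rw [← (Fin.consEquiv fun _ : Fin (n + 1) => ℕ).tsum_eq, ENNReal.tsum_prod', Fin.prod_univ_succ,
      ← ENNReal.tsum_fin_pi_prod (fun i => f i.succ), ← ENNReal.tsum_mul_right]
    refine tsum_congr fun a => ?_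
    rw [← ENNReal.tsum_mul_left]
    refine tsum_congr fun m => ?_
    simp [Fin.consEquiv, Fin.prod_univ_succ]

theorem ENNReal.tsum_pi_prod {ι : Type*} [Fintype ι] (f : ι → ℕ → ENNReal) :
    ∑' m : ι → ℕ, ∏ i, f i (m i) = ∏ i, ∑' k, f i k := by
  let e := Fintype.equivFin ι
  rw [← e.symm.prod_comp, ← ENNReal.tsum_fin_pi_prod,
    ← (e.arrowCongr (Equiv.refl ℕ)).symm.tsum_eq]
  refine tsum_congr fun m => ?_
  rw [← e.symm.prod_comp]
  simp

/-- `exp (-weight)` of a monomial, as an extended nonnegative real. -/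
def expWeight {σ : Type*} (w : σ → ℝ) (m : σ →₀ ℕ) : ENNReal :=
  ENNReal.ofReal (Real.exp (-Finsupp.weight w m))

theorem expWeight_add {σ : Type*} (w : σ → ℝ) (m m' : σ →₀ ℕ) :
    expWeight w (m + m') = expWeight w m * expWeight w m' := by
  rw [expWeight, expWeight, expWeight, ← ENNReal.ofReal_mul (Real.exp_pos _).le, ← Real.exp_add,
    map_add, neg_add]

/-- The sum of `exp (-weight)` over all monomials in finitely many variables. -/
def expSeries {σ : Type*} (s : Finset σ) (w : σ → ℝ) : ℝ :=
  ∏ i ∈ s, (1 - Real.exp (-w i))⁻¹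

theorem one_sub_exp_neg_pos {x : ℝ} (hx : 0 < x) : 0 < 1 - Real.exp (-x) := by
  simpa using hx

theorem expSeries_pos {σ : Type*} {s : Finset σ} {w : σ → ℝ} (hw : ∀ i ∈ s, 0 < w i) :
    0 < expSeries s w :=
  Finset.prod_pos fun i hi => inv_pos.2 (one_sub_exp_neg_pos (hw i hi))

theorem ENNReal.tsum_prod_exp {ι : Type*} [Fintype ι] {w : ι → ℝ} (hw : ∀ i, 0 < w i) :
    ∑' m : ι → ℕ, ENNReal.ofReal (Real.exp (-∑ i, m i * w i)) =
      ENNReal.ofReal (∏ i, (1 - Real.exp (-w i))⁻¹) := by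
  have h1 : ∀ m : ι → ℕ, ENNReal.ofReal (Real.exp (-∑ i, m i * w i)) =
      ∏ i, (ENNReal.ofReal (Real.exp (-w i))) ^ m i := fun m => by
    rw [← Finset.sum_neg_distrib, Real.exp_sum, ENNReal.ofReal_prod_of_nonneg
      fun i _ => (Real.exp_pos _).le]
    refine Finset.prod_congr rfl fun i _ => ?_
    rw [← ENNReal.ofReal_pow (Real.exp_pos _).le, ← Real.exp_nat_mul]
    congr 2; ring
  simp_rw [h1]
  rw [ENNReal.tsum_pi_prod (fun i k => (ENNReal.ofReal (Real.exp (-w i))) ^ k),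
    ENNReal.ofReal_prod_of_nonneg fun i _ => (inv_pos.2 (one_sub_exp_neg_pos (hw i))).le]
  refine Finset.prod_congr rfl fun i _ => ?_
  rw [ENNReal.tsum_geometric, ENNReal.ofReal_inv_of_pos (one_sub_exp_neg_pos (hw i)),
    ENNReal.ofReal_sub _ (Real.exp_pos _).le, ENNReal.ofReal_one]

theorem tsum_expWeight {ι : Type*} [Fintype ι] {w : ι → ℝ} (hw : ∀ i, 0 < w i) :
    ∑' m : ι →₀ ℕ, expWeight w m = ENNReal.ofReal (expSeries Finset.univ w) := by
  rw [expSeries, ← ENNReal.tsum_prod_exp hw, ← Finsupp.equivFunOnFinite.tsum_eq]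
  refine tsum_congr fun m => ?_
  simp [expWeight, Finsupp.weight_eq_sum]

theorem tsum_expWeight_comp_le {V I : Type*} (s : Finset V) {w : V → ℝ} (hw : ∀ i ∈ s, 0 < w i)
    {φ : I → (V →₀ ℕ)} (hφ : Function.Injective φ) (hs : ∀ i, (φ i).support ⊆ s) :
    ∑' i, expWeight w (φ i) ≤ ENNReal.ofReal (expSeries s w) := by
  have hinj : Function.Injective fun (i : I) (v : s) => φ i v := fun i j h => hφ <| by
    ext v
    by_cases hv : v ∈ s
    · exact congr_fun h ⟨v, hv⟩
    · rw [Finsupp.notMem_support_iff.1 fun h' => hv (hs i h'),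
        Finsupp.notMem_support_iff.1 fun h' => hv (hs j h')]
  rw [expSeries, ← Finset.prod_coe_sort s,
    ← ENNReal.tsum_prod_exp (w := fun i : s => w i) fun i => hw i i.2]
  refine le_trans (le_of_eq (tsum_congr fun i => ?_))
    (ENNReal.tsum_comp_le_tsum_of_injective hinj _)
  rw [expWeight, Finsupp.weight_apply, Finsupp.sum_of_support_subset _ (hs i) _ (by simp),
    ← Finset.sum_coe_sort s]
  simp

/-- Splitting off the multiples of a monomial `μ`. -/
theorem tsum_expWeight_not_le {σ : Type*} (w : σ → ℝ) (μ : σ →₀ ℕ) :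
    ∑' m : {m : σ →₀ ℕ // ¬ μ ≤ m}, expWeight w m + expWeight w μ * ∑' m, expWeight w m =
      ∑' m, expWeight w m := by
  have h := ENNReal.summable.tsum_add_tsum_compl (f := expWeight w) (s := {m | ¬ μ ≤ m})
    ENNReal.summable
  refine Eq.trans ?_ h
  congr 1
  rw [← ENNReal.tsum_mul_left]
  let e : (σ →₀ ℕ) ≃ ({m | ¬ μ ≤ m}ᶜ : Set (σ →₀ ℕ)) :=
    { toFun := fun m => ⟨μ + m, by simp⟩
      invFun := fun m => m - μ
      left_inv := fun m => by simp
      right_inv := fun m => Subtype.ext (add_tsub_cancel_of_le (not_not.1 m.2)) }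
  rw [← e.tsum_eq]
  exact tsum_congr fun m => (expWeight_add w μ m).symm

end Counting

section Bound

variable {K : Type*} [Field K]

/-- Polynomials in the variables from `s` all of whose monomials have `w`-weight at most `c`. -/
def boundedWeight (K : Type*) [Field K] {V : Type*} (s : Set V) (w : V → ℝ) (c : ℝ) :
    Submodule K (MvPolynomial V K) :=
  restrictSupport K {m | (m.support : Set V) ⊆ s ∧ Finsupp.weight w m ≤ c}

section boundedWeight

variable {V : Type*} {s t : Set V} {w w' : V → ℝ} {c c' : ℝ} {p q : MvPolynomial V K}

theorem mem_boundedWeight : p ∈ boundedWeight K s w c ↔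
    ∀ m ∈ p.support, (m.support : Set V) ⊆ s ∧ Finsupp.weight w m ≤ c :=
  mem_restrictSupport_iff K

theorem boundedWeight_mono (hst : s ⊆ t) (hw : ∀ v ∈ s, w' v ≤ w v) (hc : c ≤ c')
    (hp : p ∈ boundedWeight K s w c) : p ∈ boundedWeight K t w' c' := by
  rw [mem_boundedWeight] at hp ⊢
  refine fun m hm => ⟨(hp m hm).1.trans hst, le_trans ?_ ((hp m hm).2.trans hc)⟩
  rw [Finsupp.weight_apply, Finsupp.weight_apply]
  exact Finset.sum_le_sum fun v hv => nsmul_le_nsmul_right (hw v ((hp m hm).1 hv)) _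

theorem mul_mem_boundedWeight (hp : p ∈ boundedWeight K s w c)
    (hq : q ∈ boundedWeight K s w c') : p * q ∈ boundedWeight K s w (c + c') := by
  classical
  have h := Submodule.mul_mem_mul hp hq
  rw [boundedWeight, boundedWeight, ← restrictSupport_add] at h
  refine restrictSupport_mono K ?_ h
  rintro _ ⟨m, hm, m', hm', rfl⟩
  refine ⟨fun v hv => ?_, ?_⟩
  · rcases Finset.mem_union.1 (Finsupp.support_add hv) with h | h
    exacts [hm.1 h, hm'.1 h]
  · simpa using add_le_add hm.2 hm'.2

theorem monomial_mem_boundedWeight {m : V →₀ ℕ} (r : K) (hm : (m.support : Set V) ⊆ s)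
    (hc : Finsupp.weight w m ≤ c) : monomial m r ∈ boundedWeight K s w c := by
  rw [boundedWeight, monomial_mem_restrictSupport]
  exact Or.inl ⟨hm, hc⟩

theorem one_mem_boundedWeight : (1 : MvPolynomial V K) ∈ boundedWeight K s w 0 :=
  monomial_mem_boundedWeight 1 (by simp) (by simp)

theorem X_mem_boundedWeight {v : V} (hv : v ∈ s) (hc : w v ≤ c) :
    (X v : MvPolynomial V K) ∈ boundedWeight K s w c :=
  monomial_mem_boundedWeight 1
    (fun u hu => by rw [Finset.mem_singleton.1 (Finsupp.support_single_subset hu)]; exact hv)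
    (by simpa [Finsupp.weight_single] using hc)

theorem pow_mem_boundedWeight (hp : p ∈ boundedWeight K s w c) (k : ℕ) :
    p ^ k ∈ boundedWeight K s w (k * c) := by
  induction k with
  | zero => simpa using one_mem_boundedWeight
  | succ k ih =>
    rw [pow_succ, show ((k + 1 : ℕ) : ℝ) * c = k * c + c by push_cast; ring]
    exact mul_mem_boundedWeight ih hp

theorem aeval_monomial_mem_boundedWeight {ι : Type*} {e : ι → MvPolynomial V K} {a : ι → ℝ}
    (he : ∀ i, e i ∈ boundedWeight K s w (a i)) (m : ι →₀ ℕ) :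
    aeval e (monomial m (1 : K)) ∈ boundedWeight K s w (Finsupp.weight a m) := by
  induction m using Finsupp.induction_linear with
  | zero => simpa using one_mem_boundedWeight
  | add m m' h h' =>
    have : (monomial (m + m') (1 : K)) = monomial m 1 * monomial m' 1 := by simp [monomial_mul]
    rw [this, map_mul, map_add]
    exact mul_mem_boundedWeight h h'
  | single i k =>
    simpa [-aeval_eq_bind₁, aeval_monomial, Finsupp.weight_single] using
      pow_mem_boundedWeight (he i) k

end boundedWeight

/-- Every multiple of `F` has a monomial divisible by a monomial of `F` which is at least as
heavy as a prescribed one. -/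
theorem exists_monomial_le_of_dvd {ι : Type*} [Finite ι] (a : ι → ℝ) {F : MvPolynomial ι K}
    {m : ι →₀ ℕ} (hm : m ∈ F.support) :
    ∃ μ : ι →₀ ℕ, Finsupp.weight a m ≤ Finsupp.weight a μ ∧
      ∀ P : MvPolynomial ι K, F ∣ P → P ≠ 0 → ∃ m' ∈ P.support, μ ≤ m' := by
  classical
  let e := Finite.equivFin ι
  let κ : (ι →₀ ℕ) → Lex (ℝ × Lex (Fin (Nat.card ι) →₀ ℕ)) := fun m =>
    toLex (Finsupp.weight a m, toLex (Finsupp.domCongr e m))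
  have hadd : ∀ m m', κ (m + m') = κ m + κ m' := fun m m' => by
    simp only [κ, map_add]; rfl
  have hinj : Function.Injective κ := fun m m' h => by
    have h1 := congr_arg Prod.snd (toLex_inj.1 h)
    exact (Finsupp.domCongr e).injective (toLex_inj.1 h1)
  obtain ⟨μ, hμ, hmax⟩ := Finset.exists_max_image F.support κ ⟨m, hm⟩
  refine ⟨μ, ?_, ?_⟩
  · have := hmax m hm
    rcases Prod.Lex.toLex_le_toLex.1 this with h | h
    exacts [h.le, h.1.le]
  · rintro _ ⟨Q, rfl⟩ hP
    have hQ : Q ≠ 0 := right_ne_zero_of_mul hP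
    obtain ⟨b, hb, hbmax⟩ := Finset.exists_max_image Q.support κ (support_nonempty.2 hQ)
    refine ⟨μ + b, ?_, le_self_add⟩
    rw [mem_support_iff, coeff_mul, Finset.sum_eq_single (μ, b)]
    · exact mul_ne_zero (mem_support_iff.1 hμ) (mem_support_iff.1 hb)
    · rintro ⟨u, v⟩ huv hne
      by_contra h0
      have hu := hmax u (mem_support_iff.2 (left_ne_zero_of_mul h0))
      have hv := hbmax v (mem_support_iff.2 (right_ne_zero_of_mul h0))
      have heq : κ u + κ v = κ μ + κ b := by
        rw [← hadd, ← hadd, Finset.HasAntidiagonal.mem_antidiagonal.1 huv]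
      have h1 := (add_eq_add_iff_eq_and_eq hu hv).1 heq
      exact hne (Prod.ext (hinj h1.1) (hinj h1.2))
    · simp

/-- If `Ψ` turns the `q k` into independent variables over `A`, and the relations of the `e i`
modulo those variables are multiples of `F`, then the products of monomials in `e` avoiding the
multiples of a leading monomial `μ` of `F` with monomials in `q` are linearly independent. -/
theorem linearIndependent_aeval_mul_aeval {ι κ V A : Type*} [CommRing A] [Algebra K A]
    {e : ι → MvPolynomial V K} {q : κ → MvPolynomial V K}
    (Ψ : MvPolynomial V K →ₐ[K] MvPolynomial κ A) (hq : ∀ k, Ψ (q k) = X k) {μ : ι →₀ ℕ}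
    (hμ : ∀ P : MvPolynomial ι K, constantCoeff (Ψ (aeval e P)) = 0 → P ≠ 0 →
      ∃ m ∈ P.support, μ ≤ m) :
    LinearIndependent K fun i : {m : ι →₀ ℕ // ¬ μ ≤ m} × (κ →₀ ℕ) =>
      aeval e (monomial i.1.1 (1 : K)) * aeval q (monomial i.2 (1 : K)) := by
  classical
  rw [linearIndependent_iff']
  intro s l hl
  by_contra! hne
  obtain ⟨i₀, hi₀, hli₀⟩ := hne
  let T := (s.filter fun i => l i ≠ 0).image Prod.snd
  have hT : T.Nonempty := ⟨i₀.2, Finset.mem_image_of_mem _ (by simp [hi₀, hli₀])⟩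
  obtain ⟨b, hb⟩ := T.exists_minimal hT
  obtain ⟨i₁, hi₁, rfl⟩ := Finset.mem_image.1 hb.prop
  rw [Finset.mem_filter] at hi₁
  let s' := s.filter fun i => i.2 = i₁.2
  let P : MvPolynomial ι K := ∑ i ∈ s', monomial i.1.1 (l i)
  have hcoeff : ∀ m, P.coeff m = ∑ i ∈ s', if i.1.1 = m then l i else 0 := fun m => by
    simp [P, coeff_sum, coeff_monomial]
  have hP : P ≠ 0 := fun h0 => by
    have := hcoeff i₁.1.1
    rw [h0, coeff_zero, Finset.sum_eq_single i₁] at this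
    · rw [if_pos rfl] at this
      exact hi₁.2 this.symm
    · intro i hi hne
      rw [if_neg]
      intro h
      exact hne (Prod.ext (Subtype.ext h) (Finset.mem_filter.1 hi).2)
    · intro h
      exact absurd (Finset.mem_filter.2 ⟨hi₁.1, rfl⟩ : i₁ ∈ s') h
  have hΨq : ∀ m : κ →₀ ℕ, Ψ (aeval q (monomial m (1 : K))) = monomial m 1 := fun m => by
    rw [aeval_monomial, map_one, one_mul, map_finsuppProd, monomial_eq]
    simp [hq]
  have hP0 : constantCoeff (Ψ (aeval e P)) = 0 := by
    have h := congr_arg (fun x => coeff i₁.2 (Ψ x)) hl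
    simp only [map_sum, map_smul, map_mul, coeff_sum, hΨq, coeff_smul, coeff_mul_monomial',
      map_zero, coeff_zero, mul_one] at h
    rw [← Finset.sum_filter_add_sum_filter_not s (fun i => i.2 = i₁.2),
      Finset.sum_eq_zero (s := s.filter fun i => ¬ i.2 = i₁.2), add_zero] at h
    · rw [← h]
      simp only [P, map_sum]
      refine Finset.sum_congr rfl fun i hi => ?_
      rw [← (Finset.mem_filter.1 hi).2, if_pos le_rfl, tsub_self, ← constantCoeff_eq]
      rw [show monomial i.1.1 (l i) = l i • monomial i.1.1 (1 : K) by simp [smul_monomial],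
        map_smul, map_smul, constantCoeff_smul]
    · intro i hi
      rw [Finset.mem_filter] at hi
      by_cases hli : l i = 0
      · rw [hli, zero_smul]
      rw [if_neg, smul_zero]
      intro hle
      exact hi.2 (le_antisymm hle (hb.le_of_le
        (Finset.mem_image_of_mem _ (Finset.mem_filter.2 ⟨hi.1, hli⟩)) hle))
  obtain ⟨m, hm, hle⟩ := hμ P hP0 hP
  rw [mem_support_iff, hcoeff] at hm
  obtain ⟨i, -, hi⟩ := Finset.exists_ne_zero_of_sum_ne_zero hm
  refine i.1.2 ?_
  rw [(ite_ne_right_iff.1 hi).1]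
  exact hle

/-- Hilbert series form of a weighted Bézout inequality. -/
theorem one_sub_exp_mul_expSeries_le {ι κ V A : Type*} [Fintype ι] [Fintype κ] [CommRing A]
    [Algebra K A] {e : ι → MvPolynomial V K} {q : κ → MvPolynomial V K}
    (Ψ : MvPolynomial V K →ₐ[K] MvPolynomial κ A) (hq : ∀ k, Ψ (q k) = X k)
    {F : MvPolynomial ι K}
    (hF : ∀ P : MvPolynomial ι K, constantCoeff (Ψ (aeval e P)) = 0 → F ∣ P)
    (s : Finset V) {w : V → ℝ} (hw : ∀ v ∈ s, 0 < w v) {a : ι → ℝ} (ha : ∀ i, 0 < a i)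
    {b : κ → ℝ} (hb : ∀ k, 0 < b k) (hea : ∀ i, e i ∈ boundedWeight K (s : Set V) w (a i))
    (hqb : ∀ k, q k ∈ boundedWeight K (s : Set V) w (b k)) {m : ι →₀ ℕ} (hm : m ∈ F.support) :
    (1 - Real.exp (-Finsupp.weight a m)) *
      (expSeries Finset.univ a * expSeries Finset.univ b) ≤ expSeries s w := by
  obtain ⟨μ, hmμ, hμ⟩ := exists_monomial_le_of_dvd a hm
  have hli := linearIndependent_aeval_mul_aeval Ψ hq fun P hP => hμ P (hF P hP)
  obtain ⟨φ, hφ, hmem⟩ := hli.exists_injective_mem_support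
  have hφ' : ∀ i, ((φ i).support : Set V) ⊆ s ∧
      Finsupp.weight w (φ i) ≤ Finsupp.weight a i.1.1 + Finsupp.weight b i.2 := fun i =>
    mem_boundedWeight.1 (mul_mem_boundedWeight
    (aeval_monomial_mem_boundedWeight hea i.1.1) (aeval_monomial_mem_boundedWeight hqb i.2))
    _ (hmem i)
  have key : (∑' i : {m : ι →₀ ℕ // ¬ μ ≤ m}, expWeight a i) * ∑' j, expWeight b j ≤
      ENNReal.ofReal (expSeries s w) := by
    refine le_trans ?_ (tsum_expWeight_comp_le s hw hφ fun i => by exact_mod_cast (hφ' i).1)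
    rw [← ENNReal.tsum_mul_right, ENNReal.tsum_prod']
    refine ENNReal.tsum_le_tsum fun i => ?_
    rw [← ENNReal.tsum_mul_left]
    refine ENNReal.tsum_le_tsum fun j => ?_
    rw [expWeight, expWeight, expWeight, ← ENNReal.ofReal_mul (Real.exp_pos _).le, ← Real.exp_add]
    exact ENNReal.ofReal_le_ofReal (Real.exp_le_exp.2 (by linarith [(hφ' (i, j)).2]))
  have hsplit := tsum_expWeight_not_le a μ
  rw [tsum_expWeight ha] at hsplit
  rw [tsum_expWeight hb] at key
  have hg := expSeries_pos (s := Finset.univ) fun i _ => ha i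
  have hh := expSeries_pos (s := Finset.univ) fun i _ => hb i
  have hr := expSeries_pos hw
  have h1 : expSeries Finset.univ a * expSeries Finset.univ b ≤
      expSeries s w + Real.exp (-Finsupp.weight a μ) * expSeries Finset.univ a *
        expSeries Finset.univ b := by
    rw [← ENNReal.ofReal_le_ofReal_iff (by positivity), ENNReal.ofReal_mul hg.le, ← hsplit,
      add_mul, ENNReal.ofReal_add hr.le (by positivity), ENNReal.ofReal_mul (by positivity),
      ENNReal.ofReal_mul (Real.exp_pos _).le]
    exact add_le_add key le_rfl
  have h2 : Real.exp (-Finsupp.weight a μ) ≤ Real.exp (-Finsupp.weight a m) :=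
    Real.exp_le_exp.2 (by linarith)
  nlinarith [mul_le_mul_of_nonneg_right h2 (mul_pos hg hh).le]

end Bound

section Gauss

open Polynomial in
/-- A prime polynomial vanishing under a map that is injective on constants divides every
polynomial that vanishes under this map. -/
theorem Prime.dvd_of_map_eq_zero {C A : Type*} [CommRing C] [IsDomain C]
    [UniqueFactorizationMonoid C] [CommRing A] (Φ : C[X] →+* A)
    (hΦ : ∀ c : C, Φ (Polynomial.C c) = 0 → c = 0) {F P : C[X]} (hF : Prime F)
    (hF0 : Φ F = 0) (hP0 : Φ P = 0) : F ∣ P := by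
  classical
  let _ : NormalizedGCDMonoid C := Classical.choice inferInstance
  let L := FractionRing C
  have hdeg : F.natDegree ≠ 0 := fun h => by
    rw [eq_C_of_natDegree_eq_zero h] at hF0 hF
    exact hF.ne_zero (by rw [hΦ _ hF0, Polynomial.C_0])
  have hirr : Irreducible (F.map (algebraMap C L)) :=
    ((hF.irreducible.isPrimitive hdeg).irreducible_iff_irreducible_map_fraction_map).1
      hF.irreducible
  have hinj : Function.Injective (Polynomial.map (algebraMap C L)) :=
    Polynomial.map_injective _ (IsFractionRing.injective C L)
  have clear : ∀ u : L[X], ∃ b : C, b ≠ 0 ∧ ∃ u' : C[X],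
      u'.map (algebraMap C L) = (Polynomial.C b).map (algebraMap C L) * u := fun u => by
    obtain ⟨b, hb, h⟩ := IsLocalization.integerNormalization_spec (nonZeroDivisors C) u
    refine ⟨b, nonZeroDivisors.ne_zero hb, _, h.trans ?_⟩
    rw [Polynomial.map_C, ← Polynomial.smul_eq_C_mul, algebraMap_smul]
  rcases hirr.isCoprime_or_dvd (P.map (algebraMap C L)) with ⟨u, v, h⟩ | ⟨Q, h⟩
  · obtain ⟨a, ha, u', hu⟩ := clear u
    obtain ⟨b, hb, v', hv⟩ := clear v
    have h1 : Polynomial.C b * u' * F + Polynomial.C a * v' * P = Polynomial.C (a * b) := by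
      apply hinj
      simp only [Polynomial.map_add, Polynomial.map_mul, hu, hv, Polynomial.C_mul]
      linear_combination (Polynomial.C a).map (algebraMap C L) *
        (Polynomial.C b).map (algebraMap C L) * h
    have h2 : Φ (Polynomial.C (a * b)) = 0 := by
      rw [← h1, map_add, map_mul _ _ F, map_mul _ _ P, hF0, hP0, mul_zero, mul_zero, add_zero]
    exact absurd (hΦ _ h2) (mul_ne_zero ha hb)
  · obtain ⟨b, hb, Q', hQ⟩ := clear Q
    have h1 : Polynomial.C b * P = F * Q' := by
      apply hinj
      rw [Polynomial.map_mul, Polynomial.map_mul, hQ, h]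
      ring
    refine (hF.dvd_or_dvd (Dvd.intro _ h1.symm)).resolve_left fun h => hdeg ?_
    exact Nat.eq_zero_of_le_zero
      ((Polynomial.natDegree_le_of_dvd h (Polynomial.C_ne_zero.2 hb)).trans (by simp))

theorem MvPolynomial.prime_rename_of_injective {K σ τ : Type*} [Field K] {f : σ → τ}
    (hf : Function.Injective f) {p : MvPolynomial σ K} (hp : Prime p) : Prime (rename f p) := by
  have h : rename f p =
      rename ((↑) : Set.range f → τ) (renameEquiv K (Equiv.ofInjective f hf) p) := by
    rw [renameEquiv_apply, rename_rename]
    rfl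
  rw [h, prime_rename_iff]
  exact (MulEquiv.prime_iff (renameEquiv K (Equiv.ofInjective f hf))).2 hp

theorem MvPolynomial.totalDegree_le_rename_of_injective {K σ τ : Type*} [CommSemiring K]
    [Nonempty σ] {f : σ → τ} (hf : Function.Injective f) (p : MvPolynomial σ K) :
    p.totalDegree ≤ (rename f p).totalDegree := by
  conv_lhs => rw [← rename_id_apply p, ← (Function.leftInverse_invFun hf).comp_eq_id,
    ← rename_rename]
  exact totalDegree_rename_le _ _

/-- A prime relation `F` among `t none` and algebraically independent elements `t (some i)`
divides all relations. -/
theorem Prime.dvd_of_aeval_eq_zero {K J A : Type*} [Field K] [Finite J] [CommRing A] [Algebra K A]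
    {t : Option J → A} (ht : AlgebraicIndependent K fun j => t (some j))
    {F P : MvPolynomial (Option J) K} (hF : Prime F) (hF0 : aeval t F = 0)
    (hP0 : aeval t P = 0) : F ∣ P := by
  let E := optionEquivLeft K J
  let Φ : Polynomial (MvPolynomial J K) →ₐ[K] A := (aeval t).comp E.symm.toAlgHom
  have hE : ∀ Q, Φ (E Q) = aeval t Q := fun Q => by simp [Φ, E]
  have hC : ∀ c, Φ (Polynomial.C c) = aeval (fun j => t (some j)) c := fun c => by
    have : E (rename some c) = Polynomial.C c := by
      induction c using MvPolynomial.induction_on with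
      | C a => simp [E]
      | add p q hp hq => rw [map_add, map_add, hp, hq, map_add]
      | mul_X p i hp => rw [map_mul, map_mul, hp, rename_X, optionEquivLeft_X_some, map_mul]
    rw [← this, hE, aeval_rename]
    rfl
  have h := Prime.dvd_of_map_eq_zero Φ.toRingHom
    (fun c hc => (injective_iff_map_eq_zero _).1 ht c ((hC c).symm.trans hc))
    ((MulEquiv.prime_iff E).2 hF) ((hE F).trans hF0) ((hE P).trans hP0)
  exact (map_dvd_iff E).1 h

end Gauss

section Relations

variable {K : Type*} [Field K] {n : ℕ}

/-- The Lie derivative along the vector field `g`. -/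
def lieDer (g : Fin n → MvPolynomial (Fin n) K) :
    Derivation K (MvPolynomial (Fin n) K) (MvPolynomial (Fin n) K) :=
  mkDerivation K g

/-- Substitution of the iterated Lie derivatives for the derivatives of the variables. -/
def lieEval (g : Fin n → MvPolynomial (Fin n) K) :
    MvPolynomial (Fin n × ℕ) K →ₐ[K] MvPolynomial (Fin n) K :=
  aeval fun v => (lieDer g)^[v.2] (X v.1)

/-- An algebra homomorphism intertwining two derivations on the variables intertwines them. -/
theorem MvPolynomial.map_derivation_of_X {σ B : Type*} [CommRing B] [Algebra K B]
    (D : Derivation K (MvPolynomial σ K) (MvPolynomial σ K)) (E : Derivation K B B)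
    (φ : MvPolynomial σ K →ₐ[K] B) (h : ∀ v, φ (D (X v)) = E (φ (X v)))
    (p : MvPolynomial σ K) : φ (D p) = E (φ p) := by
  induction p using MvPolynomial.induction_on with
  | C a => simp [← algebraMap_eq]
  | add p q hp hq => simp only [map_add, hp, hq]
  | mul_X p v hp => simp only [Derivation.leibniz, smul_eq_mul, map_add, map_mul, hp, h]

theorem lieEval_diffDer (g : Fin n → MvPolynomial (Fin n) K) (p : MvPolynomial (Fin n × ℕ) K) :
    lieEval g (diffDer K n p) = lieDer g (lieEval g p) := by
  refine MvPolynomial.map_derivation_of_X _ _ _ (fun v => ?_) p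
  simp [lieEval, diffDer, mkDerivation_X, Function.iterate_succ_apply']

theorem lieEval_rename (g : Fin n → MvPolynomial (Fin n) K) (p : MvPolynomial (Fin n) K) :
    lieEval g (rename (fun j => (j, 0)) p) = p := by
  rw [lieEval, aeval_rename]
  exact aeval_X_left_apply p

theorem lieEval_X (g : Fin n → MvPolynomial (Fin n) K) (v : Fin n × ℕ) :
    lieEval g (X v) = (lieDer g)^[v.2] (X v.1) := by
  rw [lieEval, aeval_X]

theorem diffDer_mem_sysIdeal (g : Fin n → MvPolynomial (Fin n) K)
    {p : MvPolynomial (Fin n × ℕ) K} (hp : p ∈ sysIdeal K n g) :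
    diffDer K n p ∈ sysIdeal K n g := by
  refine Submodule.span_induction (p := fun q _ => diffDer K n q ∈ sysIdeal K n g)
    ?_ (by simp) (fun a b _ _ ha hb => ?_) (fun c a ha' ha => ?_) hp
  · rintro _ ⟨q, hq, j, rfl⟩
    exact Ideal.subset_span ⟨q, hq, j + 1, (Function.iterate_succ_apply' _ _ _).symm⟩
  · rw [map_add]
    exact add_mem ha hb
  · rw [smul_eq_mul, Derivation.leibniz]
    exact add_mem (Ideal.mul_mem_left _ _ ha) (Ideal.mul_mem_right _ _ ha')

theorem sub_rename_lieEval_mem (g : Fin n → MvPolynomial (Fin n) K)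
    (p : MvPolynomial (Fin n × ℕ) K) :
    p - rename (fun j => (j, 0)) (lieEval g p) ∈ sysIdeal K n g := by
  have hder : ∀ q : MvPolynomial (Fin n) K,
      diffDer K n (rename (fun j => (j, 0)) q) - rename (fun j => (j, 0)) (lieDer g q) ∈
        sysIdeal K n g := fun q => by
    induction q using MvPolynomial.induction_on with
    | C a => simp [← algebraMap_eq]
    | add p q hp hq =>
      simp only [map_add]
      rw [add_sub_add_comm]
      exact add_mem hp hq
    | mul_X p i hp =>
      have hi : (X (i, 1) - rename (fun j => (j, 0)) (g i) : MvPolynomial (Fin n × ℕ) K) ∈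
          sysIdeal K n g :=
        Ideal.subset_span ⟨_, ⟨i, rfl⟩, 0, rfl⟩
      have h1 : diffDer K n (X (i, 0)) = X (i, 1) := by rw [diffDer, mkDerivation_X]
      have h2 : lieDer g (X i) = g i := by rw [lieDer, mkDerivation_X]
      simp only [Derivation.leibniz, smul_eq_mul, map_add, map_mul, rename_X, h1, h2]
      rw [add_sub_add_comm, ← mul_sub, ← mul_sub]
      exact add_mem (Ideal.mul_mem_left _ _ hi) (Ideal.mul_mem_left _ _ hp)
  induction p using MvPolynomial.induction_on with
  | C a => simp [lieEval]
  | add p q hp hq =>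
    simp only [map_add]
    rw [add_sub_add_comm]
    exact add_mem hp hq
  | mul_X p v hp =>
    have hv : ∀ j : ℕ, (X (v.1, j) - rename (fun j => (j, 0)) ((lieDer g)^[j] (X v.1)) :
        MvPolynomial (Fin n × ℕ) K) ∈ sysIdeal K n g := fun j => by
      induction j with
      | zero => simp
      | succ j ih =>
        have h := add_mem (diffDer_mem_sysIdeal g ih) (hder ((lieDer g)^[j] (X v.1)))
        rw [map_sub, sub_add_sub_cancel] at h
        rw [Function.iterate_succ_apply']
        convert h using 2
        rw [diffDer, mkDerivation_X]
    have h := hv v.2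
    rw [← lieEval_X] at h
    have h' := add_mem (Ideal.mul_mem_left _ p h)
      (Ideal.mul_mem_right (rename (fun j => (j, 0)) (lieEval g (X v))) _ hp)
    rw [map_mul, map_mul]
    convert h' using 1
    ring

theorem mem_sysIdeal_iff (g : Fin n → MvPolynomial (Fin n) K) (p : MvPolynomial (Fin n × ℕ) K) :
    p ∈ sysIdeal K n g ↔ lieEval g p = 0 := by
  refine ⟨fun hp => ?_, fun hp => by simpa [hp] using sub_rename_lieEval_mem g p⟩
  have hle : sysIdeal K n g ≤ RingHom.ker (lieEval g) := by
    refine Ideal.span_le.2 ?_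
    rintro _ ⟨_, ⟨i, rfl⟩, j, rfl⟩
    rw [SetLike.mem_coe, RingHom.mem_ker]
    have hcomm : ∀ q, lieEval g ((diffDer K n)^[j] q) = (lieDer g)^[j] (lieEval g q) :=
      Function.Semiconj.iterate_right (lieEval_diffDer g) j
    rw [hcomm, map_sub, lieEval_rename, lieEval_X]
    simp only [Function.iterate_one, lieDer, mkDerivation_X, sub_self]
    exact Function.iterate_fixed (map_zero (mkDerivation K g)) j
  exact hle hp

variable [NeZero n]

theorem fst_eq_zero_of_mem_vars_rename {τ : Type*} (ζ : τ → ℕ) (Q : MvPolynomial τ K) :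
    ∀ v ∈ (rename (fun i => ((0 : Fin n), ζ i)) Q).vars, v.1 = 0 := by
  classical
  intro v hv
  obtain ⟨i, -, rfl⟩ := Finset.mem_image.1 (vars_rename _ _ hv)
  rfl

theorem ordOf_rename_le {τ : Type*} {ζ : τ → ℕ} {c : ℕ} (hζ : ∀ i, ζ i ≤ c)
    (Q : MvPolynomial τ K) : ordOf (rename (fun i => ((0 : Fin n), ζ i)) Q) ≤ c := by
  classical
  refine Finset.sup_le fun v hv => ?_
  obtain ⟨i, -, rfl⟩ := Finset.mem_image.1 (vars_rename _ _ hv)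
  exact hζ i

/-- The iterated Lie derivatives of the first coordinate. -/
def lieIter (g : Fin n → MvPolynomial (Fin n) K) (j : ℕ) : MvPolynomial (Fin n) K :=
  (lieDer g)^[j] (X 0)

theorem lieEval_rename_zero (g : Fin n → MvPolynomial (Fin n) K) {τ : Type*} (ζ : τ → ℕ)
    (Q : MvPolynomial τ K) :
    lieEval g (rename (fun i => ((0 : Fin n), ζ i)) Q) = aeval (fun i => lieIter g (ζ i)) Q := by
  rw [lieEval, aeval_rename]
  rfl

/-- The orders of the variables of a differential polynomial of order `r` in `x_1`, with the
highest one singled out. -/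
def ordVar (r : ℕ) (o : Option (Fin r)) : ℕ :=
  o.elim r (↑)

theorem ordVar_le {r : ℕ} (o : Option (Fin r)) : ordVar r o ≤ r := by
  cases o with
  | none => exact le_rfl
  | some j => exact j.2.le

theorem ordVar_injective (r : ℕ) : Function.Injective (ordVar r) := by
  rintro (_ | i) (_ | j) h
  · rfl
  · exact absurd h j.2.ne'
  · exact absurd h i.2.ne
  · exact congr_arg some (Fin.ext h)

namespace IsMinPoly

variable {g : Fin n → MvPolynomial (Fin n) K} {f : MvPolynomial (Fin n × ℕ) K}

theorem exists_rename_eq (hf : IsMinPoly K n (sysIdeal K n g) f) :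
    ∃ F : MvPolynomial (Option (Fin (ordOf f))) K,
      rename (fun o => ((0 : Fin n), ordVar _ o)) F = f := by
  refine exists_rename_eq_of_vars_subset_range f _
    (fun a b h => ordVar_injective _ (congr_arg Prod.snd h)) fun v hv => ?_
  have h1 : v.1 = 0 := hf.2.2.1 v hv
  have h2 : v.2 ≤ ordOf f := Finset.le_sup (f := Prod.snd) hv
  rcases h2.lt_or_eq with h | h
  · exact ⟨some ⟨v.2, h⟩, Prod.ext h1.symm rfl⟩
  · exact ⟨none, Prod.ext h1.symm h.symm⟩

theorem totalDegree_le (hf : IsMinPoly K n (sysIdeal K n g) f)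
    {Q : MvPolynomial (Option (Fin (ordOf f))) K} (hQ : Q ≠ 0)
    (hQ0 : aeval (fun o => lieIter g (ordVar _ o)) Q = 0) : f.totalDegree ≤ Q.totalDegree := by
  have hinj : Function.Injective fun o => ((0 : Fin n), ordVar (ordOf f) o) :=
    fun a b h => ordVar_injective _ (congr_arg Prod.snd h)
  have h := hf.2.2.2 (rename (fun o => ((0 : Fin n), ordVar _ o)) Q)
    (fun h => hQ (rename_injective _ hinj (by rw [h, map_zero])))
    ((mem_sysIdeal_iff g _).2 (by rw [lieEval_rename_zero, hQ0]))
    (fst_eq_zero_of_mem_vars_rename _ Q)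
  exact (h.2 (ordOf_rename_le ordVar_le Q)).trans (totalDegree_rename_le _ _)

theorem algebraicIndependent (hf : IsMinPoly K n (sysIdeal K n g) f) :
    AlgebraicIndependent K fun j : Fin (ordOf f) => lieIter g j := by
  refine (injective_iff_map_eq_zero _).2 fun Q hQ0 => ?_
  by_contra hQ
  have hinj : Function.Injective fun j : Fin (ordOf f) => ((0 : Fin n), (j : ℕ)) :=
    fun a b h => Fin.ext (congr_arg Prod.snd h)
  have h := hf.2.2.2 (rename (fun j : Fin (ordOf f) => ((0 : Fin n), (j : ℕ))) Q)
    (fun h => hQ (rename_injective _ hinj (by rw [h, map_zero])))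
    ((mem_sysIdeal_iff g _).2 (by rw [lieEval_rename_zero, hQ0]))
    (fst_eq_zero_of_mem_vars_rename _ Q)
  rcases Nat.eq_zero_or_pos (ordOf f) with h0 | hpos
  · have : IsEmpty (Fin (ordOf f)) := by rw [h0]; infer_instance
    obtain ⟨c, rfl⟩ := C_surjective (R := K) (Fin (ordOf f)) Q
    rw [algHom_C, map_eq_zero] at hQ0
    exact hQ (by rw [hQ0, C_0])
  · have := h.1.trans (ordOf_rename_le (c := ordOf f - 1) (fun j => by omega) Q)
    omega

theorem aeval_eq_zero (hf : IsMinPoly K n (sysIdeal K n g) f)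
    {F : MvPolynomial (Option (Fin (ordOf f))) K}
    (hF : rename (fun o => ((0 : Fin n), ordVar _ o)) F = f) :
    aeval (fun o => lieIter g (ordVar _ o)) F = 0 := by
  rw [← lieEval_rename_zero, hF]
  exact (mem_sysIdeal_iff g f).1 hf.2.1

theorem ordOf_pos (hf : IsMinPoly K n (sysIdeal K n g) f) : 0 < ordOf f := by
  obtain ⟨F, hF⟩ := hf.exists_rename_eq
  have hF0 := hf.aeval_eq_zero hF
  by_contra! h0
  have hs : ∀ o, ordVar (ordOf f) o = 0 := fun o => by have := ordVar_le o; omega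
  have hss : Subsingleton (Option (Fin (ordOf f))) :=
    ⟨fun a b => ordVar_injective _ ((hs a).trans (hs b).symm)⟩
  have hX : AlgebraicIndependent K fun o : Option (Fin (ordOf f)) => lieIter g (ordVar _ o) := by
    simp only [hs]
    exact (algebraicIndependent_X (Fin n) K).comp (fun _ : Option (Fin (ordOf f)) => 0)
      (Function.injective_of_subsingleton _)
  have := (injective_iff_map_eq_zero _).1 hX F hF0
  exact hf.1 (by rw [← hF, this, map_zero])

theorem prime (hf : IsMinPoly K n (sysIdeal K n g) f)
    {F : MvPolynomial (Option (Fin (ordOf f))) K}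
    (hF : rename (fun o => ((0 : Fin n), ordVar _ o)) F = f) : Prime F := by
  have hF0 := hf.aeval_eq_zero hF
  have hne : F ≠ 0 := fun h => hf.1 (by rw [← hF, h, map_zero])
  have hunit : ∀ {a b}, F = a * b → aeval (fun o => lieIter g (ordVar _ o)) a = 0 →
      IsUnit b := fun {a b} hab ha0 => by
    have ha : a ≠ 0 := left_ne_zero_of_mul (hab ▸ hne)
    have hb : b ≠ 0 := right_ne_zero_of_mul (hab ▸ hne)
    have h1 := hf.totalDegree_le ha ha0
    have h2 := MvPolynomial.totalDegree_le_rename_of_injective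
      (f := fun o => ((0 : Fin n), ordVar (ordOf f) o))
      (fun a b h => ordVar_injective _ (congr_arg Prod.snd h)) F
    have h3 : F.totalDegree = a.totalDegree + b.totalDegree := by
      rw [hab, totalDegree_mul_of_isDomain ha hb]
    rw [hF] at h2
    rw [totalDegree_eq_zero_iff_eq_C.1 (by omega : b.totalDegree = 0)] at hb ⊢
    exact (isUnit_iff_ne_zero.2 fun h => hb (by rw [h, C_0])).map C
  refine Irreducible.prime ⟨fun hu => ?_, fun a b hab => ?_⟩
  · exact not_isUnit_zero (hF0 ▸ hu.map _)
  · rw [hab, map_mul] at hF0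
    rcases mul_eq_zero.1 hF0 with h | h
    · exact Or.inr (hunit hab h)
    · exact Or.inl (hunit (hab.trans (mul_comm a b)) h)

end IsMinPoly

/-- Algebraically independent elements can be completed to a transcendence basis of the
polynomial ring by some of the variables. -/
theorem AlgebraicIndependent.exists_sumElim_X {r : ℕ} {h : Fin r → MvPolynomial (Fin n) K}
    (hh : AlgebraicIndependent K h) :
    ∃ S : Finset (Fin n), S.card + r = n ∧
      AlgebraicIndependent K (Sum.elim h fun i : S => X (i : Fin n)) := by
  classical
  have hspan : Algebra.adjoin K (Set.range h ∪ Set.range (X : Fin n → MvPolynomial (Fin n) K)) =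
      ⊤ := top_unique (adjoin_range_X.symm.le.trans (Algebra.adjoin_mono Set.subset_union_right))
  have halg : Algebra.IsAlgebraic (Algebra.adjoin K (Set.range h ∪
      Set.range (X : Fin n → MvPolynomial (Fin n) K))) (MvPolynomial (Fin n) K) :=
    ⟨fun a => isAlgebraic_algebraMap (R := Algebra.adjoin K (Set.range h ∪
      Set.range (X : Fin n → MvPolynomial (Fin n) K))) ⟨a, hspan ▸ Algebra.mem_top⟩⟩
  obtain ⟨u, hsu, hut, hu⟩ := exists_isTranscendenceBasis_between (R := K) (Set.range h)
    (Set.range h ∪ Set.range X) Set.subset_union_left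
    ((algebraicIndependent_subtype_range hh.injective).2 hh)
  let S : Finset (Fin n) := Finset.univ.filter fun i => X i ∈ u \ Set.range h
  have hS : ∀ i : S, X (i : Fin n) ∈ u \ Set.range h := fun i => (Finset.mem_filter.1 i.2).2
  let θ : Fin r ⊕ S → u :=
    Sum.elim (fun j => ⟨h j, hsu ⟨j, rfl⟩⟩) fun i => ⟨X i, (hS i).1⟩
  have hθinj : Function.Injective θ := by
    rintro (j | i) (j' | i') heq
    · exact congr_arg Sum.inl (hh.injective (congr_arg Subtype.val heq))
    · exact absurd ⟨j, congr_arg Subtype.val heq⟩ (hS i').2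
    · exact absurd ⟨j', (congr_arg Subtype.val heq).symm⟩ (hS i).2
    · exact congr_arg Sum.inr (Subtype.ext (X_injective (congr_arg Subtype.val heq)))
  have hθsurj : Function.Surjective θ := by
    rintro ⟨a, ha⟩
    by_cases har : a ∈ Set.range h
    · obtain ⟨j, rfl⟩ := har
      exact ⟨Sum.inl j, rfl⟩
    · obtain ⟨i, rfl⟩ := (hut ha).resolve_left har
      exact ⟨Sum.inr ⟨i, Finset.mem_filter.2 ⟨Finset.mem_univ _, ha, har⟩⟩, rfl⟩
  have hX : IsTranscendenceBasis K (X : Fin n → MvPolynomial (Fin n) K) :=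
    .mvPolynomial' _ _
  refine ⟨S, ?_, ?_⟩
  · have hc := congr_arg Cardinal.toNat (hu.lift_cardinalMk_eq hX)
    rw [Cardinal.toNat_lift, Cardinal.toNat_lift, ← Nat.card, ← Nat.card,
      ← Nat.card_eq_of_bijective θ ⟨hθinj, hθsurj⟩] at hc
    simpa [add_comm] using hc
  · convert hu.1.comp θ hθinj using 1
    funext x
    rcases x with j | i <;> rfl

end Relations

section Weights

variable {K V : Type*} [Field K] {s t : Set V} {w : V → ℝ} {c : ℝ} {p : MvPolynomial V K}

theorem boundedWeight_smul {a : ℝ} (ha : 0 ≤ a) (hp : p ∈ boundedWeight K s w c) :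
    p ∈ boundedWeight K s (fun v => a * w v) (a * c) := by
  rw [mem_boundedWeight] at hp ⊢
  refine fun m hm => ⟨(hp m hm).1, ?_⟩
  have h : Finsupp.weight (fun v => a * w v) m = a * Finsupp.weight w m := by
    simp only [Finsupp.weight_apply, Finsupp.sum, Finset.mul_sum, nsmul_eq_mul]
    exact Finset.sum_congr rfl fun _ _ => by ring
  rw [h]
  exact mul_le_mul_of_nonneg_left (hp m hm).2 ha

theorem rename_mem_boundedWeight {σ : Type*} {ζ : σ → V} (hs : Set.range ζ ⊆ s)
    (hw : ∀ i, w (ζ i) = 1) {q : MvPolynomial σ K} (hq : (q.totalDegree : ℝ) ≤ c) :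
    rename ζ q ∈ boundedWeight K s w c := by
  classical
  refine mem_boundedWeight.2 fun m hm => ?_
  obtain ⟨u, rfl, hu⟩ := coeff_rename_ne_zero _ _ _ (mem_support_iff.1 hm)
  refine ⟨fun v hv => ?_, ?_⟩
  · obtain ⟨i, -, rfl⟩ := Finset.mem_image.1 (Finsupp.mapDomain_support hv)
    exact hs ⟨i, rfl⟩
  · have h : Finsupp.weight w (Finsupp.mapDomain ζ u) = u.sum fun _ k => (k : ℝ) := by
      rw [Finsupp.weight_apply, Finsupp.sum_mapDomain_index (by simp) (by simp [add_mul])]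
      exact Finsupp.sum_congr fun i _ => by rw [hw, nsmul_one]
    rw [h]
    refine le_trans ?_ hq
    rw [Finsupp.sum, ← Nat.cast_sum]
    exact Nat.cast_le.2 (le_totalDegree (mem_support_iff.2 hu))

theorem derivation_mem_boundedWeight (D : Derivation K (MvPolynomial V K) (MvPolynomial V K))
    {τ : ℝ} (hst : s ⊆ t) (hD : ∀ v ∈ s, D (X v) ∈ boundedWeight K t w (w v + τ))
    (hp : p ∈ boundedWeight K s w c) : D p ∈ boundedWeight K t w (c + τ) := by
  rw [p.as_sum, map_sum]
  refine sum_mem fun m hm => ?_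
  obtain ⟨hms, hmc⟩ := mem_boundedWeight.1 hp m hm
  have hDm : D = mkDerivation K fun v => D (X v) := derivation_ext fun v => by
    rw [mkDerivation_X]
  rw [hDm, mkDerivation_monomial]
  refine Submodule.smul_mem _ _ (sum_mem fun v hv => ?_)
  have hw := Finsupp.weight_sub_single_add (w := w) (Finsupp.mem_support_iff.1 hv)
  simp only [smul_eq_mul]
  refine boundedWeight_mono subset_rfl (fun _ _ => le_rfl) (c := Finsupp.weight w
    (m - Finsupp.single v 1) + (w v + τ)) (by linarith) (mul_mem_boundedWeight ?_ (hD v (hms hv)))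
  exact monomial_mem_boundedWeight _ (fun u hu => hst (hms (Finsupp.support_tsub hu))) le_rfl

end Weights

section Jet

variable {K : Type*} [Field K] {n : ℕ} [NeZero n]

/-- The derivation on `K[x_1, …, x_n, y_1, y_2, …]` given by the vector field `g`, except that
`x_1, y_1, y_2, …` is regarded as the sequence of derivatives of a free variable. -/
def auxDer (g : Fin n → MvPolynomial (Fin n) K) :
    Derivation K (MvPolynomial (Fin n ⊕ ℕ) K) (MvPolynomial (Fin n ⊕ ℕ) K) :=
  mkDerivation K (Sum.elim (fun i => if i = 0 then X (Sum.inr 0) else rename Sum.inl (g i))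
    fun j => X (Sum.inr (j + 1)))

/-- The derivation on `K[x_1, …, x_n, y_1, y_2, …]` given by the vector field `g` with an
additional generic perturbation `y_1` of the first coordinate. -/
def jetDer (g : Fin n → MvPolynomial (Fin n) K) :
    Derivation K (MvPolynomial (Fin n ⊕ ℕ) K) (MvPolynomial (Fin n ⊕ ℕ) K) :=
  mkDerivation K (Sum.elim
    (fun i => rename Sum.inl (g i) + if i = 0 then X (Sum.inr 0) else 0)
    fun j => X (Sum.inr (j + 1)))

/-- The `j`-th derivative of the free variable. -/
def jetVar (n : ℕ) [NeZero n] : ℕ → Fin n ⊕ ℕ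
  | 0 => Sum.inl 0
  | j + 1 => Sum.inr j

/-- The derivatives of `x_1' - g_1` with respect to `auxDer`. -/
def jetEq (g : Fin n → MvPolynomial (Fin n) K) (k : ℕ) : MvPolynomial (Fin n ⊕ ℕ) K :=
  (auxDer g)^[k] (X (Sum.inr 0) - rename Sum.inl (g 0))

/-- Substitution of the derivatives with respect to `jetDer`. -/
def jetEval (g : Fin n → MvPolynomial (Fin n) K) :
    MvPolynomial (Fin n ⊕ ℕ) K →ₐ[K] MvPolynomial (Fin n ⊕ ℕ) K :=
  aeval (Sum.elim (fun i => X (Sum.inl i)) fun j => (jetDer g)^[j + 1] (X (Sum.inl 0)))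

theorem jetEval_rename (g : Fin n → MvPolynomial (Fin n) K) (p : MvPolynomial (Fin n) K) :
    jetEval g (rename Sum.inl p) = rename Sum.inl p := by
  rw [jetEval, aeval_rename, Sum.elim_comp_inl, rename_eq_aeval]
  rfl

theorem jetEval_jetVar (g : Fin n → MvPolynomial (Fin n) K) (j : ℕ) :
    jetEval g (X (jetVar n j)) = (jetDer g)^[j] (X (Sum.inl 0)) := by
  cases j <;> simp [jetEval, jetVar]

theorem jetEval_auxDer (g : Fin n → MvPolynomial (Fin n) K) (p : MvPolynomial (Fin n ⊕ ℕ) K) :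
    jetEval g (auxDer g p) = jetDer g (jetEval g p) := by
  refine MvPolynomial.map_derivation_of_X _ _ _ (fun v => ?_) p
  rcases v with i | j
  · rcases eq_or_ne i 0 with rfl | hi
    · simp [auxDer, mkDerivation_X, jetEval]
    · simp only [auxDer, mkDerivation_X, Sum.elim_inl, if_neg hi, jetEval_rename]
      simp [jetEval, jetDer, mkDerivation_X, hi]
  · simp [auxDer, mkDerivation_X, jetEval, Function.iterate_succ_apply']

theorem jetDer_iterate_X (g : Fin n → MvPolynomial (Fin n) K) (k : ℕ) :
    (jetDer g)^[k] (X (Sum.inr 0)) = X (Sum.inr k) := by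
  induction k with
  | zero => rfl
  | succ k ih => rw [Function.iterate_succ_apply', ih, jetDer, mkDerivation_X, Sum.elim_inr]

theorem auxDer_iterate_X (g : Fin n → MvPolynomial (Fin n) K) (k : ℕ) :
    (auxDer g)^[k] (X (Sum.inr 0)) = X (Sum.inr k) := by
  induction k with
  | zero => rfl
  | succ k ih => rw [Function.iterate_succ_apply', ih, auxDer, mkDerivation_X, Sum.elim_inr]

theorem jetEval_jetEq (g : Fin n → MvPolynomial (Fin n) K) (k : ℕ) :
    jetEval g (jetEq g k) = X (Sum.inr k) := by
  have hcomm : ∀ q, jetEval g ((auxDer g)^[k] q) = (jetDer g)^[k] (jetEval g q) :=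
    Function.Semiconj.iterate_right (jetEval_auxDer g) k
  rw [jetEq, hcomm, map_sub, jetEval_rename, ← jetDer_iterate_X g k]
  congr 1
  have h := jetEval_jetVar g 1
  rw [jetVar, Function.iterate_one, jetDer, mkDerivation_X, Sum.elim_inl, if_pos rfl] at h
  rw [h, add_sub_cancel_left]

theorem aeval_jetDer_iterate (g : Fin n → MvPolynomial (Fin n) K) (j : ℕ) :
    aeval (Sum.elim X 0) ((jetDer g)^[j] (X (Sum.inl 0))) = lieIter g j := by
  have hcomm : ∀ q, aeval (Sum.elim X 0) ((jetDer g)^[j] q) =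
      (lieDer g)^[j] (aeval (Sum.elim X 0) q) :=
    Function.Semiconj.iterate_right (MvPolynomial.map_derivation_of_X _ _ _ fun v => by
      rcases v with i | j
      · have h : aeval (Sum.elim X 0) (rename (Sum.inl : Fin n → Fin n ⊕ ℕ) (g i)) = g i := by
          rw [aeval_rename, Sum.elim_comp_inl, aeval_X_left_apply]
        have h' : aeval (Sum.elim X 0 : Fin n ⊕ ℕ → MvPolynomial (Fin n) K)
            (if i = 0 then X (Sum.inr 0) else (0 : MvPolynomial (Fin n ⊕ ℕ) K)) = 0 := by
          split_ifs <;> simp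
        rw [jetDer, lieDer, mkDerivation_X, aeval_X, Sum.elim_inl, Sum.elim_inl, mkDerivation_X,
          map_add, h, h', add_zero]
      · simp [jetDer, mkDerivation_X]) j
  rw [hcomm, aeval_X, Sum.elim_inl, lieIter]

/-- The variables of `auxDer^k` applied to a polynomial in `x_1, …, x_n`. -/
def jetSet (n k : ℕ) : Set (Fin n ⊕ ℕ) :=
  {v | Sum.elim (fun _ => True) (· < k) v}

theorem auxDer_iterate_mem {g : Fin n → MvPolynomial (Fin n) K} {τ : ℝ}
    (hg : ∀ i ≠ 0, ((g i).totalDegree : ℝ) ≤ 1 + τ) (k : ℕ) :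
    (auxDer g)^[k] (rename Sum.inl (g 0)) ∈ boundedWeight K (jetSet n k)
      (Sum.elim (fun _ => 1) fun j => 1 + (j + 1) * τ) ((g 0).totalDegree + k * τ) := by
  have hinl : ∀ k, Set.range (Sum.inl : Fin n → Fin n ⊕ ℕ) ⊆ jetSet n k := by
    rintro k _ ⟨i, rfl⟩
    trivial
  induction k with
  | zero => exact rename_mem_boundedWeight (hinl 0) (fun _ => rfl) (by simp)
  | succ k ih =>
    rw [Function.iterate_succ_apply', show ((g 0).totalDegree : ℝ) + (k + 1 : ℕ) * τ =
      (g 0).totalDegree + k * τ + τ by push_cast; ring]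
    refine derivation_mem_boundedWeight _ ?_ ?_ ih
    · rintro (i | j) hv
      exacts [trivial, hv.trans k.lt_succ_self]
    · rintro (i | j) hv
      · rw [auxDer, mkDerivation_X, Sum.elim_inl, Sum.elim_inl]
        split_ifs with hi
        · exact X_mem_boundedWeight k.succ_pos (by simp)
        · exact rename_mem_boundedWeight (hinl _) (fun _ => rfl) (hg i hi)
      · rw [auxDer, mkDerivation_X, Sum.elim_inr, Sum.elim_inr]
        refine X_mem_boundedWeight (Nat.succ_lt_succ hv) ?_
        rw [Sum.elim_inr]
        push_cast
        linarith

/-- The weights of the variables when the `j`-th derivative of the free variable has weight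
`w j`. -/
def jetWeight (n : ℕ) (w : ℕ → ℝ) : Fin n ⊕ ℕ → ℝ :=
  Sum.elim (fun _ => 1) fun j => w (j + 1)

theorem jetEq_mem {g : Fin n → MvPolynomial (Fin n) K} {w : ℕ → ℝ} {τ W : ℝ} {k r : ℕ}
    (hg : ∀ i ≠ 0, ((g i).totalDegree : ℝ) ≤ 1 + τ) (hk : k < r)
    (hw : ∀ j, 0 < j → j ≤ k → w j ≤ 1 + j * τ) (hwW : w (k + 1) ≤ W)
    (hW : (g 0).totalDegree + k * τ ≤ W) :
    jetEq g k ∈ boundedWeight K (jetSet n r) (jetWeight n w) W := by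
  have hsub : (auxDer g)^[k] (X (Sum.inr 0) - rename Sum.inl (g 0)) =
      (auxDer g)^[k] (X (Sum.inr 0)) - (auxDer g)^[k] (rename Sum.inl (g 0)) :=
    iterate_map_sub (auxDer g) k _ _
  rw [jetEq, hsub, auxDer_iterate_X]
  refine sub_mem (X_mem_boundedWeight hk hwW)
    (boundedWeight_mono ?_ ?_ hW (auxDer_iterate_mem hg k))
  · rintro (i | j) hv
    exacts [trivial, lt_trans hv hk]
  · rintro (i | j) hv
    · exact le_rfl
    · have := hw (j + 1) j.succ_pos hv
      push_cast at this
      exact this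

end Jet

section WeightedBound

theorem le_prod_of_forall_exp {δ : ℝ} {r : ℕ} {W : ℕ → ℝ}
    (h : ∀ t : ℝ, 0 < t → (1 - Real.exp (-(t * δ))) * (1 - Real.exp (-t)) ^ r ≤
      (1 - Real.exp (-t)) * ∏ k ∈ Finset.range r, (1 - Real.exp (-(t * W k)))) :
    δ ≤ ∏ k ∈ Finset.range r, W k := by
  open Filter Topology in
  have hlim : ∀ x : ℝ, Tendsto (fun t : ℝ => t⁻¹ * (1 - Real.exp (-(t * x)))) (𝓝[>] 0) (𝓝 x) :=
    fun x => by
      have hder : HasDerivAt (fun t : ℝ => 1 - Real.exp (-(t * x))) x 0 := by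
        have := ((hasDerivAt_mul_const (x := (0 : ℝ)) x).neg.exp).const_sub 1
        simpa using this
      have hsub : Set.Ioi (0 : ℝ) ⊆ {0}ᶜ := fun t ht => ne_of_gt ht
      simpa using (hasDerivAt_iff_tendsto_slope_zero.1 hder).mono_left (nhdsWithin_mono 0 hsub)
  have hone : Filter.Tendsto (fun t : ℝ => t⁻¹ * (1 - Real.exp (-t)))
      (nhdsWithin 0 (Set.Ioi 0)) (nhds 1) := by simpa using hlim 1
  have hl := (hlim δ).mul (hone.pow r)
  have hr := hone.mul (tendsto_finsetProd (Finset.range r) fun k _ => hlim (W k))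
  rw [one_pow, mul_one] at hl
  rw [one_mul] at hr
  refine le_of_tendsto_of_tendsto hl hr (Filter.eventually_of_mem self_mem_nhdsWithin
    fun t ht => ?_)
  have ht' : 0 < t⁻¹ ^ (r + 1) := pow_pos (inv_pos.2 ht) _
  have := mul_le_mul_of_nonneg_left (h t ht) ht'.le
  simp only [Finset.prod_mul_distrib, Finset.prod_const, Finset.card_range]
  rw [mul_pow]
  convert this using 1 <;> ring

variable {K : Type*} [Field K] {n : ℕ}

theorem coe_disjSum_range (r : ℕ) :
    (((Finset.univ : Finset (Fin n)).disjSum (Finset.range r) : Finset (Fin n ⊕ ℕ)) :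
      Set (Fin n ⊕ ℕ)) = jetSet n r := by
  ext v
  rcases v with i | j <;> simp [jetSet]

theorem expSeries_disjSum_range (r : ℕ) (w : ℕ → ℝ) (t : ℝ) :
    expSeries ((Finset.univ : Finset (Fin n)).disjSum (Finset.range r))
      (fun v => t * jetWeight n w v) =
      (1 - Real.exp (-t))⁻¹ ^ n * ∏ j ∈ Finset.range r, (1 - Real.exp (-(t * w (j + 1))))⁻¹ := by
  simp [expSeries, Finset.prod_disjSum, jetWeight, mul_comm]

theorem weight_mapDomain {α β : Type*} (w : β → ℝ) (φ : α → β) (u : α →₀ ℕ) :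
    Finsupp.weight w (Finsupp.mapDomain φ u) = Finsupp.weight (w ∘ φ) u := by
  rw [Finsupp.weight_apply, Finsupp.weight_apply,
    Finsupp.sum_mapDomain_index (by simp) (by simp [add_mul])]
  rfl

/-- Projection to the perturbations, over the polynomial ring in the original variables. -/
def jetCoeff (K : Type*) [Field K] (n r : ℕ) :
    MvPolynomial (Fin n ⊕ ℕ) K →ₐ[K] MvPolynomial (Fin r) (MvPolynomial (Fin n) K) :=
  aeval (Sum.elim (fun i => C (X i)) fun k => if h : k < r then X ⟨k, h⟩ else 0)

theorem constantCoeff_jetCoeff (r : ℕ) (p : MvPolynomial (Fin n ⊕ ℕ) K) :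
    constantCoeff (jetCoeff K n r p) = aeval (Sum.elim X 0) p := by
  induction p using MvPolynomial.induction_on with
  | C a => simp [jetCoeff, algebraMap_eq, MvPolynomial.algebraMap_apply]
  | add p q hp hq => simp only [map_add, hp, hq]
  | mul_X p v hp =>
    rw [map_mul, map_mul, map_mul, hp]
    congr 1
    rcases v with i | k
    · simp [jetCoeff]
    · by_cases hk : k < r <;> simp [jetCoeff, hk]

variable [NeZero n]

theorem IsMinPoly.one_sub_exp_mul_le {g : Fin n → MvPolynomial (Fin n) K}
    {f : MvPolynomial (Fin n × ℕ) K} (hf : IsMinPoly K n (sysIdeal K n g) f)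
    {w W : ℕ → ℝ} (hw0 : w 0 = 1) (hw : ∀ i, 0 < w i) (hW : ∀ k < ordOf f, 0 < W k)
    (hmem : ∀ k < ordOf f, jetEq g k ∈ boundedWeight K (jetSet n (ordOf f)) (jetWeight n w) (W k))
    {m : (Fin n × ℕ) →₀ ℕ} (hm : coeff m f ≠ 0) {t : ℝ} (ht : 0 < t) :
    (1 - Real.exp (-(t * Finsupp.weight (fun v : Fin n × ℕ => w v.2) m))) *
        (1 - Real.exp (-t)) ^ ordOf f ≤
      (1 - Real.exp (-t)) * ∏ k ∈ Finset.range (ordOf f), (1 - Real.exp (-(t * W k))) := by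
  obtain ⟨F, hF⟩ := hf.exists_rename_eq
  obtain ⟨S, hS, hind⟩ := hf.algebraicIndependent.exists_sumElim_X
  have hr := hf.ordOf_pos
  have hprime := hf.prime hF
  have hF0 := hf.aeval_eq_zero hF
  generalize ordOf f = r at *
  let z : Option (Fin r ⊕ S) → Fin n ⊕ ℕ :=
    fun o => o.elim (jetVar n r) (Sum.elim (fun j => jetVar n j) fun i => Sum.inl i)
  let ζ : Option (Fin r) → Option (Fin r ⊕ S) := Option.map Sum.inl
  let Ψ := (jetCoeff K n r).comp (jetEval g)
  have hζ : Function.Injective ζ := Option.map_injective Sum.inl_injective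
  let T : Option (Fin r ⊕ S) → MvPolynomial (Fin n) K :=
    fun o => o.elim (lieIter g r) (Sum.elim (fun j => lieIter g j) fun i => X (i : Fin n))
  have hcc : ∀ P, constantCoeff (Ψ (aeval (fun o => X (z o)) P)) = aeval T P := fun P => by
    change constantCoeff (jetCoeff K n r (jetEval g _)) = _
    rw [constantCoeff_jetCoeff, ← AlgHom.comp_apply, ← AlgHom.comp_apply]
    congr 1
    refine algHom_ext fun o => ?_
    rcases o with _ | j | i
    · rw [AlgHom.comp_apply, AlgHom.comp_apply, aeval_X, aeval_X]
      exact (congr_arg _ (jetEval_jetVar g r)).trans (aeval_jetDer_iterate g r)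
    · rw [AlgHom.comp_apply, AlgHom.comp_apply, aeval_X, aeval_X]
      exact (congr_arg _ (jetEval_jetVar g j)).trans (aeval_jetDer_iterate g j)
    · simp [T, z, jetEval]
  have hdvd : ∀ P, constantCoeff (Ψ (aeval (fun o => X (z o)) P)) = 0 → rename ζ F ∣ P :=
    fun P hP => by
      refine Prime.dvd_of_aeval_eq_zero (t := T) ?_
        (MvPolynomial.prime_rename_of_injective hζ hprime) ?_ ((hcc P).symm.trans hP)
      · exact hind
      · rw [aeval_rename, ← hF0]
        exact congr_arg (fun φ => aeval φ F) (funext fun o => by cases o <;> rfl)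
  have hq : ∀ k : Fin r, Ψ (jetEq g k) = X k := fun k => by
    change jetCoeff K n r (jetEval g _) = _
    rw [jetEval_jetEq]
    simp [jetCoeff]
  have hwz : ∀ j, jetWeight n w (jetVar n j) = w j := fun j => by
    cases j with
    | zero => exact hw0.symm
    | succ j => rfl
  have hzs : ∀ o, z o ∈ jetSet n r := by
    have : ∀ j ≤ r, jetVar n j ∈ jetSet n r := fun j hj => by
      cases j with
      | zero => trivial
      | succ j => exact hj
    rintro (_ | j | i)
    exacts [this _ le_rfl, this _ j.2.le, trivial]
  have hpos : ∀ v, 0 < jetWeight n w v := by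
    rintro (i | j)
    exacts [one_pos, hw _]
  obtain ⟨u, rfl, hu⟩ := coeff_rename_ne_zero _ _ _ (hF.symm ▸ hm)
  have hu' : Finsupp.mapDomain ζ u ∈ (rename ζ F).support := by
    rwa [mem_support_iff, coeff_rename_mapDomain _ hζ]
  have key := one_sub_exp_mul_expSeries_le Ψ hq hdvd
    ((Finset.univ : Finset (Fin n)).disjSum (Finset.range r))
    (w := fun v => t * jetWeight n w v) (fun v _ => mul_pos ht (hpos v))
    (a := fun o => t * jetWeight n w (z o)) (fun o => mul_pos ht (hpos _))
    (b := fun k => t * W k) (fun k => mul_pos ht (hW k k.2))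
    (fun o => X_mem_boundedWeight (by rw [coe_disjSum_range]; exact hzs o) le_rfl)
    (fun k => by rw [coe_disjSum_range]; exact boundedWeight_smul ht.le (hmem k k.2)) hu'
  have hweight : Finsupp.weight (fun o => t * jetWeight n w (z o)) (Finsupp.mapDomain ζ u) =
      t * Finsupp.weight (fun v : Fin n × ℕ => w v.2)
        (Finsupp.mapDomain (fun o => (0, ordVar r o)) u) := by
    have hζz : ∀ o, jetWeight n w (z (ζ o)) = w (ordVar r o) := by
      rintro (_ | j)
      exacts [hwz r, hwz j]
    rw [weight_mapDomain, weight_mapDomain, Finsupp.weight_apply, Finsupp.weight_apply,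
      Finsupp.sum, Finsupp.sum, Finset.mul_sum]
    refine Finset.sum_congr rfl fun o _ => ?_
    rw [Function.comp_apply, Function.comp_apply, hζz, mul_smul_comm]
  have hp : 0 < 1 - Real.exp (-t) := one_sub_exp_neg_pos ht
  have hseries : expSeries Finset.univ (fun o => t * jetWeight n w (z o)) =
      (1 - Real.exp (-t))⁻¹ ^ (S.card + 1) *
        ∏ j ∈ Finset.range r, (1 - Real.exp (-(t * w (j + 1))))⁻¹ := by
    have hsplit := (Finset.prod_range_succ (fun j => (1 - Real.exp (-(t * w j)))⁻¹) r).symm.trans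
      (Finset.prod_range_succ' _ r)
    rw [hw0, mul_one, Finset.prod_range] at hsplit
    rw [expSeries, Fintype.prod_option, Fintype.prod_sum_type]
    have h1 : ∀ i : S, jetWeight n w (z (some (Sum.inr i))) = 1 := fun _ => rfl
    have h2 : ∀ j : Fin r, jetWeight n w (z (some (Sum.inl j))) = w j := fun j => hwz j
    have h3 : jetWeight n w (z none) = w r := hwz r
    simp only [h1, h2, h3, mul_one, Finset.prod_const, Finset.card_univ, Fintype.card_coe]
    rw [pow_succ]
    linear_combination (1 - Real.exp (-t))⁻¹ ^ S.card * hsplit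
  have hseries' : expSeries Finset.univ (fun k : Fin r => t * W k) =
      (∏ k ∈ Finset.range r, (1 - Real.exp (-(t * W k))))⁻¹ := by
    rw [expSeries, Finset.prod_range, Finset.prod_inv_distrib]
  rw [hweight, hseries, hseries', expSeries_disjSum_range] at key
  have hA : 0 < ∏ j ∈ Finset.range r, (1 - Real.exp (-(t * w (j + 1))))⁻¹ :=
    Finset.prod_pos fun j _ => inv_pos.2 (one_sub_exp_neg_pos (mul_pos ht (hw _)))
  have hB : 0 < ∏ k ∈ Finset.range r, (1 - Real.exp (-(t * W k))) :=
    Finset.prod_pos fun k hk =>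
      one_sub_exp_neg_pos (mul_pos ht (hW k (Finset.mem_range.1 hk)))
  have hpn : (1 - Real.exp (-t))⁻¹ ^ n = (1 - Real.exp (-t))⁻¹ ^ (S.card + r) := by rw [hS]
  rw [hpn] at key
  generalize 1 - Real.exp (-t) = p, S.card = c,
    ∏ j ∈ Finset.range r, (1 - Real.exp (-(t * w (j + 1))))⁻¹ = A,
    ∏ k ∈ Finset.range r, (1 - Real.exp (-(t * W k))) = B at key hA hB hp ⊢
  have := mul_le_mul_of_nonneg_left key (by positivity : 0 ≤ p ^ (c + r + 1) * A⁻¹ * B)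
  simp only [inv_pow] at this
  have hright : p * B = p ^ (c + r + 1) * A⁻¹ * B * ((p ^ (c + r))⁻¹ * A) := by
    rw [pow_succ]
    field_simp
  rw [hright]
  refine Eq.trans_le ?_ this
  simp only [pow_add, pow_one]
  field_simp

theorem IsMinPoly.weight_le_prod {g : Fin n → MvPolynomial (Fin n) K}
    {f : MvPolynomial (Fin n × ℕ) K} (hf : IsMinPoly K n (sysIdeal K n g) f)
    {ω M : ℕ → ℝ} {D : ℝ} (hω0 : ω 0 = 1) (hω : ∀ j, 0 ≤ ω j)
    (hD : ∀ i ≠ 0, ((g i).totalDegree : ℝ) ≤ D) (hMω : ∀ k, ω (k + 1) ≤ M k)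
    (hMD : ∀ k : ℕ, (g 0).totalDegree + k * (D - 1) ≤ M k)
    (hMj : ∀ k j : ℕ, 0 < j → j ≤ k → (g 0).totalDegree + (k / j : ℝ) * (ω j - 1) ≤ M k)
    {m : (Fin n × ℕ) →₀ ℕ} (hm : coeff m f ≠ 0) :
    Finsupp.weight (fun v : Fin n × ℕ => ω v.2) m ≤ ∏ k ∈ Finset.range (ordOf f), M k := by
  have hε : ∀ ε : ℝ, 0 < ε → Finsupp.weight (fun v : Fin n × ℕ => ω v.2 + v.2 * ε) m ≤
      ∏ k ∈ Finset.range (ordOf f), (M k + (k + 1) * ε) := fun ε hε => by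
    have hWw : ∀ k : ℕ, ω (k + 1) + ((k + 1 : ℕ) : ℝ) * ε ≤ M k + (k + 1) * ε := fun k => by
      push_cast
      linarith [hMω k]
    have hpos : ∀ j : ℕ, 0 < ω j + j * ε := fun j => by
      rcases j.eq_zero_or_pos with rfl | hj
      · simp [hω0]
      · have : (0 : ℝ) < j * ε := mul_pos (Nat.cast_pos.2 hj) hε
        linarith [hω j]
    refine le_prod_of_forall_exp fun t ht => hf.one_sub_exp_mul_le (w := fun j => ω j + j * ε)
      (W := fun k => M k + (k + 1) * ε) (by simp [hω0]) hpos
      (fun k _ => (hpos (k + 1)).trans_le (hWw k)) (fun k hk => ?_) hm ht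
    rcases k.eq_zero_or_pos with rfl | hk0
    · refine jetEq_mem (τ := D - 1) (by simpa using hD) hk (fun j h1 h2 => by omega) (hWw 0) ?_
      have := hMD 0
      push_cast at this ⊢
      linarith
    · have hk' : (0 : ℝ) < k := Nat.cast_pos.2 hk0
      refine jetEq_mem (τ := (M k - (g 0).totalDegree) / k + ε) (fun i hi => ?_) hk
        (fun j h1 h2 => ?_) (hWw k) ?_
      · have h1 : D - 1 ≤ (M k - (g 0).totalDegree) / k := by
          rw [le_div_iff₀ hk']
          linarith [hMD k]
        linarith [hD i hi]
      · have hj' : (0 : ℝ) < j := Nat.cast_pos.2 h1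
        have h3 : ω j - 1 ≤ j * ((M k - (g 0).totalDegree) / k) := by
          rw [mul_div_assoc', le_div_iff₀ hk']
          have := mul_le_mul_of_nonneg_left (hMj k j h1 h2) hj'.le
          rw [mul_add, ← mul_assoc, mul_div_cancel₀ _ hj'.ne'] at this
          linarith
        linarith
      · rw [mul_add, mul_div_cancel₀ _ hk'.ne']
        linarith
  have hl : Continuous fun ε : ℝ => Finsupp.weight (fun v : Fin n × ℕ => ω v.2 + v.2 * ε) m := by
    simp only [Finsupp.weight_apply, Finsupp.sum, nsmul_eq_mul]
    fun_prop
  have hr : Continuous fun ε : ℝ => ∏ k ∈ Finset.range (ordOf f), (M k + (k + 1) * ε) := by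
    fun_prop
  have := le_of_tendsto_of_tendsto ((hl.tendsto 0).mono_left nhdsWithin_le_nhds)
    ((hr.tendsto 0).mono_left nhdsWithin_le_nhds)
    (Filter.eventually_of_mem (self_mem_nhdsWithin (s := Set.Ioi 0)) hε)
  simpa using this

theorem IsMinPoly.weight_eq {I : Ideal (MvPolynomial (Fin n × ℕ) K)}
    {f : MvPolynomial (Fin n × ℕ) K} (hf : IsMinPoly K n I f) {ν : ℕ} (hν : ordOf f ≤ ν)
    (ω : ℕ → ℝ) {m : (Fin n × ℕ) →₀ ℕ} (hm : coeff m f ≠ 0) :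
    Finsupp.weight (fun v : Fin n × ℕ => ω v.2) m =
      m (0, 0) * ω 0 + ∑ j ∈ Finset.range ν, ω (j + 1) * m (0, j + 1) := by
  have hsub : m.support ⊆ (Finset.range (ν + 1)).map (Function.Embedding.sectR (0 : Fin n) ℕ) :=
    fun v hv => by
      have hv' : v ∈ f.vars := (mem_vars_iff_mem_support v).2 ⟨m, mem_support_iff.2 hm, hv⟩
      have h2 : v.2 ≤ ordOf f := Finset.le_sup (f := Prod.snd) hv'
      refine Finset.mem_map.2 ⟨v.2, Finset.mem_range.2 (by omega), ?_⟩
      exact Prod.ext (hf.2.2.1 v hv').symm rfl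
  rw [Finsupp.weight_apply, Finsupp.sum_of_support_subset _ hsub _ (by simp), Finset.sum_map,
    Finset.sum_range_succ', add_comm]
  simp [mul_comm]

end WeightedBound

theorem statement3 (K : Type*) [Field K] [CharZero K] (n : ℕ) [NeZero n]
    (g : Fin n → MvPolynomial (Fin n) K) (d D : ℕ)
    (hd : d = (g 0).totalDegree) (hd0 : 0 < d)
    (hD : D = (Finset.univ.filter fun i : Fin n => i ≠ 0).sup fun i => (g i).totalDegree)
    (hD0 : 0 < D)
    (f : MvPolynomial (Fin n × ℕ) K) (hf : IsMinPoly K n (sysIdeal K n g) f)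
    (ν : ℕ) (hν : 0 < ν) (hord : ordOf f ≤ ν)
    (ω : ℕ → ℕ)
    (m : (Fin n × ℕ) →₀ ℕ) (hm : MvPolynomial.coeff m f ≠ 0) :
    (m ((0 : Fin n), 0) : ℝ) + ∑ i ∈ Finset.Icc 1 ν, (ω i : ℝ) * (m ((0 : Fin n), i) : ℝ) ≤
      ∏ k ∈ Finset.Icc 1 ν,
        (insert ((ω k : ℝ))
          (insert ((d : ℝ) + ((k : ℝ) - 1) * ((D : ℝ) - 1))
            ((Finset.Icc 1 (k - 1)).image fun j : ℕ =>
              (d : ℝ) + (((k : ℝ) - 1) / (j : ℝ)) * ((ω j : ℝ) - 1)))).max'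
          (Finset.insert_nonempty _ _) := by
  have hIcc : Finset.Icc 1 ν = (Finset.range ν).map (addRightEmbedding 1) := by
    ext k
    simp only [Finset.mem_Icc, Finset.mem_map, Finset.mem_range, addRightEmbedding_apply]
    exact ⟨fun h => ⟨k - 1, by omega, by omega⟩, by rintro ⟨j, hj, rfl⟩; omega⟩
  rw [hIcc, Finset.sum_map, Finset.prod_map]
  simp only [addRightEmbedding_apply, Nat.add_sub_cancel]
  have hD' : (1 : ℝ) ≤ D := Nat.one_le_cast.2 hD0
  have hd' : (1 : ℝ) ≤ d := Nat.one_le_cast.2 hd0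
  have hgD : ∀ i ≠ 0, ((g i).totalDegree : ℝ) ≤ D := fun i hi => Nat.cast_le.2 (by
    rw [hD]
    exact Finset.le_sup (f := fun i => (g i).totalDegree)
      (Finset.mem_filter.2 ⟨Finset.mem_univ i, hi⟩))
  have hmax : ∀ k : ℕ, (1 : ℝ) ≤ (insert ((ω (k + 1) : ℝ))
      (insert ((d : ℝ) + (((k + 1 : ℕ) : ℝ) - 1) * ((D : ℝ) - 1))
        ((Finset.Icc 1 k).image fun j : ℕ =>
          (d : ℝ) + ((((k + 1 : ℕ) : ℝ) - 1) / (j : ℝ)) * ((ω j : ℝ) - 1)))).max'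
      (Finset.insert_nonempty _ _) := fun k => by
    refine le_trans ?_ (Finset.le_max' _ (d + (((k + 1 : ℕ) : ℝ) - 1) * ((D : ℝ) - 1)) (by simp))
    have : 0 ≤ (((k + 1 : ℕ) : ℝ) - 1) * ((D : ℝ) - 1) :=
      mul_nonneg (by simp) (sub_nonneg.2 hD')
    linarith
  refine le_trans ?_ (Finset.prod_le_prod_of_subset_of_one_le (Finset.range_mono hord)
    (fun k _ => ?_) (fun k _ _ => ?_))
  · have h := hf.weight_le_prod (ω := fun j => if j = 0 then 1 else (ω j : ℝ))
      (M := fun k => (insert ((ω (k + 1) : ℝ))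
          (insert ((d : ℝ) + (((k + 1 : ℕ) : ℝ) - 1) * ((D : ℝ) - 1))
            ((Finset.Icc 1 k).image fun j : ℕ =>
              (d : ℝ) + ((((k + 1 : ℕ) : ℝ) - 1) / (j : ℝ)) * ((ω j : ℝ) - 1)))).max'
          (Finset.insert_nonempty _ _)) (D := D) (by simp)
      (fun j => by split_ifs <;> positivity) hgD (fun k => ?_) (fun k => ?_)
      (fun k j h1 h2 => ?_) hm
    · have hw := hf.weight_eq hord (fun j => if j = 0 then 1 else (ω j : ℝ)) hm
      simpa using hw.symm.trans_le h
    · exact Finset.le_max' _ _ (by simp)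
    · exact Finset.le_max' _ _ (by simp [hd])
    · refine Finset.le_max' _ _ (Finset.mem_insert_of_mem (Finset.mem_insert_of_mem
        (Finset.mem_image.2 ⟨j, Finset.mem_Icc.2 ⟨h1, h2⟩, ?_⟩)))
      simp [hd, h1.ne']
  · exact zero_le_one.trans (hmax k)
  · exact hmax k
end
end

section
/- Let K be a field of characteristic zero and let g be a square-free polynomial in K[x_1, ..., x_n, y]. Then for every nonnegative integer ω there exists a K-algebra homomorphism φ : K[x_1, ..., x_n, y] → K[x_1, ..., x_n, z] with φ(x_i) = x_i for all i and φ(y) = p(z) for some p ∈ K[z] with deg p = ω, such that φ(g) is square-free. -/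
open MvPolynomial

noncomputable section

/-- A consequence of Gauss's lemma: a square-free polynomial over a UFD remains square-free over
the fraction field. -/
theorem Polynomial.squarefree_map_fractionRing {R : Type*} [CommRing R] [IsDomain R]
    [UniqueFactorizationMonoid R] {g : Polynomial R} (hg : Squarefree g) :
    Squarefree (g.map (algebraMap R (FractionRing R))) := by
  obtain ⟨_⟩ : Nonempty (NormalizedGCDMonoid R) := inferInstance
  intro q hq
  have hinj : Function.Injective (algebraMap R (FractionRing R)) :=
    IsFractionRing.injective R (FractionRing R)
  obtain ⟨b, hb, hN⟩ := IsLocalization.integerNormalization_spec (nonZeroDivisors R) q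
  set N := IsLocalization.integerNormalization (nonZeroDivisors R) q
  have hb0 : algebraMap R (FractionRing R) b ≠ 0 := by
    simpa using nonZeroDivisors.ne_zero hb
  have hN' : N.map (algebraMap R (FractionRing R)) =
      Polynomial.C (algebraMap R (FractionRing R) b) * q := by
    rw [hN, ← Polynomial.smul_eq_C_mul, algebraMap_smul]
  have hg0 : g ≠ 0 := hg.ne_zero
  have hq0 : q ≠ 0 := by
    rintro rfl
    rw [zero_mul, zero_dvd_iff, Polynomial.map_eq_zero_iff hinj] at hq
    exact hg0 hq
  have hN0 : N ≠ 0 := by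
    rintro h
    rw [h, Polynomial.map_zero] at hN'
    exact mul_ne_zero (Polynomial.C_ne_zero.mpr hb0) hq0 hN'.symm
  have hunit : ∀ r : R, r ≠ 0 →
      IsUnit (Polynomial.C (algebraMap R (FractionRing R) r)) := fun r hr =>
    Polynomial.isUnit_C.mpr (IsUnit.mk0 _ (by simpa using hr))
  have hassoc : ∀ p : Polynomial R, p ≠ 0 →
      Associated (p.primPart.map (algebraMap R (FractionRing R)))
        (p.map (algebraMap R (FractionRing R))) := by
    intro p hp
    have h := congrArg (Polynomial.map (algebraMap R (FractionRing R)))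
      p.eq_C_content_mul_primPart
    rw [Polynomial.map_mul, Polynomial.map_C] at h
    rw [h]
    exact (associated_unit_mul_left _ _
      (hunit _ (by rwa [Ne, Polynomial.content_eq_zero_iff]))).symm
  have hPq : Associated (N.primPart.map (algebraMap R (FractionRing R))) q := by
    refine (hassoc N hN0).trans ?_
    rw [hN']
    exact associated_unit_mul_left _ _ (hunit b (nonZeroDivisors.ne_zero hb))
  have hdvd : N.primPart * N.primPart ∣ g.primPart := by
    refine (N.isPrimitive_primPart.mul N.isPrimitive_primPart).dvd_of_fraction_map_dvd_fraction_map
      (K := FractionRing R) ?_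
    rw [Polynomial.map_mul]
    exact ((hPq.mul_mul hPq).dvd.trans hq).trans (hassoc g hg0).symm.dvd
  have hu := hg _ (hdvd.trans g.primPart_dvd)
  exact hPq.isUnit (hu.map (Polynomial.mapRingHom (algebraMap R (FractionRing R))))

/-- In characteristic zero, the ideal generated by a square-free polynomial and its derivative
contains a nonzero constant. -/
theorem Polynomial.exists_C_eq_of_squarefree {R : Type*} [CommRing R] [IsDomain R]
    [UniqueFactorizationMonoid R] [CharZero R] {g : Polynomial R} (hg : Squarefree g) :
    ∃ (r : R) (a b : Polynomial R), r ≠ 0 ∧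
      Polynomial.C r = a * g + b * Polynomial.derivative g := by
  have : CharZero (FractionRing R) :=
    charZero_of_injective_algebraMap (IsFractionRing.injective R (FractionRing R))
  obtain ⟨a, b, hab⟩ :=
    PerfectField.separable_iff_squarefree.mpr (Polynomial.squarefree_map_fractionRing hg)
  obtain ⟨α, hα, hA⟩ := IsLocalization.integerNormalization_spec (nonZeroDivisors R) a
  obtain ⟨β, hβ, hB⟩ := IsLocalization.integerNormalization_spec (nonZeroDivisors R) b
  set A := IsLocalization.integerNormalization (nonZeroDivisors R) a
  set B := IsLocalization.integerNormalization (nonZeroDivisors R) b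
  refine ⟨α * β, Polynomial.C β * A, Polynomial.C α * B,
    mul_ne_zero (nonZeroDivisors.ne_zero hα) (nonZeroDivisors.ne_zero hβ), ?_⟩
  apply Polynomial.map_injective _ (IsFractionRing.injective R (FractionRing R))
  rw [← algebraMap_smul (FractionRing R), Polynomial.smul_eq_C_mul] at hA hB
  simp only [Polynomial.map_add, Polynomial.map_mul, Polynomial.map_C, hA, hB, map_mul]
  rw [← Polynomial.derivative_map]
  linear_combination (-Polynomial.C (algebraMap R (FractionRing R) α) *
    Polynomial.C (algebraMap R (FractionRing R) β)) * hab

namespace MvPolynomial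

variable {σ K : Type*} [Field K]

theorem optionEquivLeft_pderiv_none (f : MvPolynomial (Option σ) K) :
    optionEquivLeft K σ (pderiv none f) = Polynomial.derivative (optionEquivLeft K σ f) := by
  induction f using MvPolynomial.induction_on with
  | C a => simp
  | add p q hp hq => simp [hp, hq]
  | mul_X p i hp =>
    cases i with
    | none => simp [hp, Derivation.leibniz, pderiv_X_self]; ring
    | some i => simp [hp, Derivation.leibniz, pderiv_X_of_ne]; ring

theorem optionEquivLeft_rename_some (r : MvPolynomial σ K) :
    optionEquivLeft K σ (rename some r) = Polynomial.C r := by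
  induction r using MvPolynomial.induction_on with
  | C a => simp
  | add p q hp hq => simp [hp, hq]
  | mul_X p i hp => simp [hp]

/-- In characteristic zero, the ideal generated by a square-free polynomial and its partial
derivative with respect to `v` contains a nonzero polynomial not involving `v`. -/
theorem exists_notMem_vars_of_squarefree [CharZero K] (v : σ) {g : MvPolynomial σ K}
    (hg : Squarefree g) :
    ∃ r a b : MvPolynomial σ K, r ≠ 0 ∧ v ∉ r.vars ∧ r = a * g + b * pderiv v g := by
  classical
  let s : Option {x // x ≠ v} ≃ σ := Equiv.optionSubtypeNe v
  let e := optionEquivLeft K {x // x ≠ v}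
  let f := renameEquiv K s
  have hsq : Squarefree (e (f.symm g)) := by
    intro q hq
    have h : f (e.symm q) * f (e.symm q) ∣ g := by
      simpa using map_dvd f (map_dvd e.symm hq)
    simpa using ((hg _ h).map f.symm).map e
  obtain ⟨r, a, b, hr, h⟩ := Polynomial.exists_C_eq_of_squarefree hsq
  have hs : s none = v := Equiv.optionSubtypeNe_none v
  have hd : f (pderiv none (f.symm g)) = pderiv v g := by
    have := pderiv_rename (R := K) s.injective none (f.symm g)
    rw [hs] at this
    change rename s _ = _
    rw [← this]
    exact congrArg (pderiv v) (f.apply_symm_apply g)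
  refine ⟨f (rename some r), f (e.symm a), f (e.symm b), ?_, ?_, ?_⟩
  · simpa using (rename_injective _ (Option.some_injective _)).ne hr
  · intro hv
    obtain ⟨i, hi, hiv⟩ := mem_vars_rename _ _ hv
    obtain ⟨j, -, rfl⟩ := mem_vars_rename _ _ hi
    exact j.2 (by simpa [s] using hiv)
  · rw [← hd]
    conv_lhs => rw [← e.symm_apply_apply (rename some r)]
    rw [optionEquivLeft_rename_some, h]
    rw [← optionEquivLeft_pderiv_none]
    simp [e]

theorem notMem_vars_of_dvd {v : σ} {h r : MvPolynomial σ K} (hr : r ≠ 0) (hv : v ∉ r.vars)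
    (hd : h ∣ r) : v ∉ h.vars := by
  obtain ⟨k, rfl⟩ := hd
  have hh : h ≠ 0 := left_ne_zero_of_mul hr
  have hk : k ≠ 0 := right_ne_zero_of_mul hr
  simp only [mem_vars_iff_degreeOf_ne_zero, not_not, degreeOf_mul_eq hh hk] at hv ⊢
  lia

theorem isUnit_of_forall_notMem_vars {h : MvPolynomial σ K} (h0 : h ≠ 0)
    (hv : ∀ v, v ∉ h.vars) : IsUnit h := by
  obtain ⟨c, rfl⟩ : ∃ c, C c = h :=
    ⟨_, (vars_eq_empty_iff_eq_C.mp (Finset.eq_empty_of_forall_notMem hv)).symm⟩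
  exact (IsUnit.mk0 c (by rintro rfl; simp at h0)).map C

theorem dvd_pderiv_of_mul_self_dvd {h f : MvPolynomial σ K} (hd : h * h ∣ f) (v : σ) :
    h ∣ pderiv v f := by
  obtain ⟨k, rfl⟩ := hd
  simp only [Derivation.leibniz, smul_eq_mul]
  exact ⟨h * pderiv v k + k * (pderiv v h + pderiv v h), by ring⟩

section Substitution

variable {τ : Type*} (P : MvPolynomial (τ ⊕ Unit) K)

/-- The endomorphism of `K[x, z]` fixing every `x i` and sending `z` to `P`. -/
def substInr : MvPolynomial (τ ⊕ Unit) K →ₐ[K] MvPolynomial (τ ⊕ Unit) K :=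
  aeval (Sum.elim (fun i => X (Sum.inl i)) fun _ => P)

theorem eval_substInr {s : τ ⊕ Unit → K} {t : τ ⊕ Unit → K}
    (hst : ∀ i, t (Sum.inl i) = s (Sum.inl i)) (hP : eval t P = s (Sum.inr ()))
    (f : MvPolynomial (τ ⊕ Unit) K) : eval t (substInr P f) = eval s f := by
  induction f using MvPolynomial.induction_on with
  | C a => simp [substInr]
  | add p q hp hq => simp [hp, hq]
  | mul_X p i hp =>
    rw [map_mul, map_mul, map_mul, hp]
    cases i <;> simp [hst, hP, substInr]

theorem pderiv_inl_substInr {i : τ} (hP : Sum.inl i ∉ P.vars) (f : MvPolynomial (τ ⊕ Unit) K) :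
    pderiv (Sum.inl i) (substInr P f) = substInr P (pderiv (Sum.inl i) f) := by
  classical
  have hP' := pderiv_eq_zero_of_notMem_vars hP
  induction f using MvPolynomial.induction_on with
  | C a => simp [substInr]
  | add p q hp hq => simp [hp, hq]
  | mul_X p j hp =>
    rw [map_mul, Derivation.leibniz, Derivation.leibniz, hp]
    cases j with
    | inl j => by_cases h : j = i <;> simp [substInr, pderiv_X, h]
    | inr j => simp [substInr, hP', pderiv_X]

theorem pderiv_inr_substInr (f : MvPolynomial (τ ⊕ Unit) K) :
    pderiv (Sum.inr ()) (substInr P f) =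
      substInr P (pderiv (Sum.inr ()) f) * pderiv (Sum.inr ()) P := by
  classical
  induction f using MvPolynomial.induction_on with
  | C a => simp [substInr]
  | add p q hp hq => simp [hp, hq, add_mul]
  | mul_X p j hp =>
    rw [map_mul, Derivation.leibniz, Derivation.leibniz, hp]
    cases j with
    | inl j => simp [substInr, pderiv_X]; ring
    | inr j => simp [substInr, pderiv_X]; ring

theorem inl_notMem_vars_substInr {i : τ} (hP : Sum.inl i ∉ P.vars)
    {f : MvPolynomial (τ ⊕ Unit) K} (hf : Sum.inl i ∉ f.vars) :
    Sum.inl i ∉ (substInr P f).vars := by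
  intro h
  obtain ⟨j, hj, hij⟩ := mem_vars_bind₁ _ f h
  cases j with
  | inl j =>
    have : i = j := by simpa [vars_X] using hij
    exact hf (this ▸ hj)
  | inr j => exact hP hij

theorem inr_notMem_vars_substInr {f : MvPolynomial (τ ⊕ Unit) K}
    (h : Sum.inr () ∉ P.vars ∨ Sum.inr () ∉ f.vars) : Sum.inr () ∉ (substInr P f).vars := by
  intro h'
  obtain ⟨j, hj, hij⟩ := mem_vars_bind₁ _ f h'
  cases j with
  | inl j => simp [vars_X] at hij
  | inr j => exact h.elim (fun h => h hij) fun h => h hj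

/-- A square-free polynomial `g` in `x` and `z` admits a nonzero `c` such that substituting for `z`
a polynomial in `z` with constant term `c`, which is constant or has a monomial as derivative,
preserves the square-freeness of `g`. -/
theorem exists_squarefree_substInr [CharZero K] [Finite τ] {g : MvPolynomial (τ ⊕ Unit) K}
    (hg : Squarefree g) :
    ∃ c : K, c ≠ 0 ∧ ∀ P : MvPolynomial (τ ⊕ Unit) K, (∀ i, Sum.inl i ∉ P.vars) →
      (∀ t : τ ⊕ Unit → K, t (Sum.inr ()) = 0 → eval t P = c) →
      (Sum.inr () ∉ P.vars ∨ ∃ (u : K) (k : ℕ), u ≠ 0 ∧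
        pderiv (Sum.inr ()) P = C u * X (Sum.inr ()) ^ k) →
      Squarefree (substInr P g) := by
  have := Fintype.ofFinite τ
  choose r a b hr hv hrab using fun v => exists_notMem_vars_of_squarefree v hg
  have hne : g * (∏ v, r v) * X (Sum.inr ()) ≠ 0 :=
    mul_ne_zero (mul_ne_zero hg.ne_zero (Finset.prod_ne_zero_iff.mpr fun v _ => hr v))
      (X_ne_zero _)
  obtain ⟨s, hs⟩ : ∃ s, eval s (g * (∏ v, r v) * X (Sum.inr ())) ≠ 0 := by
    by_contra! h
    exact hne (MvPolynomial.funext fun s => by rw [h s, map_zero])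
  simp only [map_mul, eval_X, map_prod, mul_ne_zero_iff, Finset.prod_ne_zero_iff,
    Finset.mem_univ, true_imp_iff] at hs
  obtain ⟨⟨hsg, hsr⟩, hc⟩ := hs
  refine ⟨s (Sum.inr ()), hc, fun P hP hPe hPd => ?_⟩
  let t : τ ⊕ Unit → K := Sum.elim (fun i => s (Sum.inl i)) 0
  have ht : ∀ f, eval t (substInr P f) = eval s f :=
    eval_substInr P (fun _ => rfl) (hPe t rfl)
  have hne : ∀ f, eval s f ≠ 0 → substInr P f ≠ 0 := by
    rintro f hf h
    rw [← ht, h, map_zero] at hf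
    exact hf rfl
  refine (squarefree_iff_no_irreducibles (hne g hsg)).mpr fun h hirr hdvd => ?_
  have hdg : h ∣ substInr P g := (dvd_mul_right h h).trans hdvd
  refine hirr.not_isUnit (isUnit_of_forall_notMem_vars hirr.ne_zero ?_)
  rintro (i | ⟨⟩)
  · refine notMem_vars_of_dvd (hne _ (hsr (Sum.inl i)))
      (inl_notMem_vars_substInr P (hP i) (hv (Sum.inl i))) ?_
    rw [hrab, map_add, map_mul, map_mul, ← pderiv_inl_substInr P (hP i)]
    exact dvd_add (hdg.mul_left _) ((dvd_pderiv_of_mul_self_dvd hdvd _).mul_left _)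
  · obtain hz | ⟨u, k, hu, hPd⟩ := hPd
    · exact notMem_vars_of_dvd (hne g hsg) (inr_notMem_vars_substInr P (Or.inl hz)) hdg
    · refine notMem_vars_of_dvd (hne _ (hsr (Sum.inr ())))
        (inr_notMem_vars_substInr P (Or.inr (hv (Sum.inr ())))) ?_
      have hdr : h ∣ substInr P (r (Sum.inr ())) * (C u * X (Sum.inr ()) ^ k) := by
        rw [hrab, map_add, map_mul, map_mul, ← hPd, add_mul, mul_assoc (substInr P (b _)),
          ← pderiv_inr_substInr]
        exact dvd_add ((hdg.mul_left _).mul_right _)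
          ((dvd_pderiv_of_mul_self_dvd hdvd _).mul_left _)
      refine (hirr.prime.dvd_or_dvd hdr).resolve_right fun hd => ?_
      obtain hd | hd := hirr.prime.dvd_or_dvd hd
      · exact hirr.not_isUnit (isUnit_of_dvd_unit hd ((IsUnit.mk0 u hu).map C))
      · have hX : Associated h (X (Sum.inr ())) :=
          hirr.associated_of_dvd X_prime.irreducible (hirr.prime.dvd_of_dvd_pow hd)
        have h0 := map_dvd (eval t) (hX.symm.dvd.trans hdg)
        rw [ht, eval_X] at h0
        exact hsg (zero_dvd_iff.mp h0)

end Substitution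

end MvPolynomial

theorem statement6 (K : Type*) [Field K] [CharZero K] (n : ℕ)
    (g : MvPolynomial (Fin n ⊕ Unit) K) (hg : Squarefree g) (ω : ℕ) :
    ∃ p : Polynomial K, p.degree = (ω : WithBot ℕ) ∧
      Squarefree
        (MvPolynomial.aeval
          (Sum.elim (fun i : Fin n => (X (Sum.inl i) : MvPolynomial (Fin n ⊕ Unit) K))
            (fun _ : Unit =>
              Polynomial.aeval (X (Sum.inr ()) : MvPolynomial (Fin n ⊕ Unit) K) p)) g) := by
  obtain ⟨c, hc, h⟩ := exists_squarefree_substInr hg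
  rcases Nat.eq_zero_or_pos ω with rfl | hω
  · refine ⟨Polynomial.C c, Polynomial.degree_C hc, h _ ?_ ?_ (Or.inl ?_)⟩ <;>
      simp [MvPolynomial.algebraMap_eq]
  · have hmem : ∀ i : Fin n, Sum.inl i ∉
        (X (Sum.inr ()) ^ ω + C c : MvPolynomial (Fin n ⊕ Unit) K).vars := by
      classical
      intro i hi
      rcases Finset.mem_union.mp (vars_add_subset _ _ hi) with hi | hi
      · simpa [vars_X] using vars_pow _ _ hi
      · simp at hi
    refine ⟨Polynomial.X ^ ω + Polynomial.C c, Polynomial.degree_X_pow_add_C hω c,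
      h _ ?_ ?_ (Or.inr ⟨ω, ω - 1, ?_, ?_⟩)⟩
    · simpa [MvPolynomial.algebraMap_eq] using hmem
    · intro t ht
      simp [MvPolynomial.algebraMap_eq, ht, hω.ne']
    · exact_mod_cast hω.ne'
    · simp [MvPolynomial.algebraMap_eq, Derivation.leibniz_pow]
end
end

section
/- Let K be a field of characteristic zero and g = (g_1, ..., g_n) ∈ K[x_1, ..., x_n]^n with deg g_i ≤ D for all 2 ≤ i ≤ n. For α, β ∈ ℤ_{≥0}^n let m(α, β) := x_1^{β_1}⋯x_n^{β_n}(x_1')^{α_1}⋯(x_1^{(n)})^{α_n}, ℓ_1(α, β) := Σ_{i=1}^{n} β_i + Σ_{i=1}^{n} (iD − i + 1) α_i, and ℓ_2(α) := Σ_{i=1}^{n} i α_i. Then for every monomial m(α, β) and every monomial m(α̃, β̃) appearing with nonzero coefficient in 𝓛*_g(m(α, β)), one has ℓ_1(α̃, β̃) ≤ ℓ_1(α, β) + D − 1 and ℓ_2(α̃) ≤ ℓ_2(α) + 1. -/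
open MvPolynomial

noncomputable section

/-- The operator `𝓛*_g = Σ_{i=2}^n g_i ∂/∂x_i + Σ_{j≥0} x_1^{(j+1)} ∂/∂x_1^{(j)}` on
`K[x_1^{(∞)}, x_2, …, x_n]`, extended by zero on the remaining variables `x_i^{(j)}`,
`i ≠ 1`, `j ≥ 1`. -/
def lieStar (K : Type*) [CommRing K] (n : ℕ) [NeZero n]
    (g : Fin n → MvPolynomial (Fin n) K) :
    Derivation K (MvPolynomial (Fin n × ℕ) K) (MvPolynomial (Fin n × ℕ) K) :=
  MvPolynomial.mkDerivation K fun v =>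
    if v.1 = 0 then X (v.1, v.2 + 1)
    else if v.2 = 0 then rename (fun j => (j, 0)) (g v.1) else 0

/-- The exponent vector of the monomial
`m(α, β) = x_1^{β_1} ⋯ x_n^{β_n} (x_1')^{α_1} ⋯ (x_1^{(n)})^{α_n}`,
where `α j` (for `j : Fin n`) is the exponent of `x_1^{(j+1)}` and `β i` is the
exponent of `x_i`. -/
def EV (n : ℕ) [NeZero n] (α β : Fin n → ℕ) : (Fin n × ℕ) →₀ ℕ :=
  (∑ i : Fin n, Finsupp.single (i, 0) (β i)) +
    ∑ j : Fin n, Finsupp.single ((0 : Fin n), (j : ℕ) + 1) (α j)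

/-- If a derivation raises the weight of each variable by at most `c`, then it raises the weight of
every monomial by at most `c`. -/
theorem weight_le_of_coeff_mkDerivation_monomial_ne_zero {σ R : Type*} [CommSemiring R]
    (w : σ → ℕ) (c : ℕ) (f : σ → MvPolynomial σ R)
    (hf : ∀ v e, coeff e (f v) ≠ 0 → Finsupp.weight w e ≤ w v + c)
    (s e : σ →₀ ℕ) (r : R) (h : coeff e (mkDerivation R f (monomial s r)) ≠ 0) :
    Finsupp.weight w e ≤ Finsupp.weight w s + c := by
  classical
  rw [mkDerivation_monomial, coeff_smul, Finsupp.sum, coeff_sum] at h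
  obtain ⟨i, hi, h⟩ := Finset.exists_ne_zero_of_sum_ne_zero (right_ne_zero_of_smul h)
  rw [smul_eq_mul, coeff_monomial_mul'] at h
  split_ifs at h with hle
  · have hw := hf i _ (right_ne_zero_of_mul h)
    have hs : Finsupp.single i 1 ≤ s := by
      rw [Finsupp.single_le_iff]
      exact Nat.one_le_iff_ne_zero.2 (Finsupp.mem_support_iff.1 hi)
    have h₁ := congrArg (Finsupp.weight w) (add_tsub_cancel_of_le hle)
    have h₂ := congrArg (Finsupp.weight w) (add_tsub_cancel_of_le hs)
    simp only [map_add, Finsupp.weight_single, one_smul] at h₁ h₂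
    omega
  · exact absurd rfl h

/-- Weight bound for `lieStar`, from bounds on the weights of `x_1^{(j)}` and of the `g i`. -/
theorem weight_le_of_coeff_lieStar_monomial_ne_zero {K : Type*} [CommRing K] {n : ℕ} [NeZero n]
    (g : Fin n → MvPolynomial (Fin n) K) (w : Fin n × ℕ → ℕ) (c : ℕ)
    (hsucc : ∀ j, w (0, j + 1) ≤ w (0, j) + c)
    (hg : ∀ i, i ≠ 0 → ∀ u, coeff u (g i) ≠ 0 →
      Finsupp.weight (fun k => w (k, 0)) u ≤ w (i, 0) + c)
    (s e : Fin n × ℕ →₀ ℕ) (r : K) (h : coeff e (lieStar K n g (monomial s r)) ≠ 0) :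
    Finsupp.weight w e ≤ Finsupp.weight w s + c := by
  classical
  refine weight_le_of_coeff_mkDerivation_monomial_ne_zero w c _ ?_ s e r h
  rintro ⟨i, j⟩ e he
  dsimp only at he
  split_ifs at he with hi hj
  · rw [coeff_X] at he
    subst hi
    obtain rfl : Finsupp.single (0, j + 1) 1 = e := by
      by_contra hne
      exact he (if_neg hne)
    simpa [Finsupp.weight_single] using hsucc j
  · subst hj
    obtain ⟨u, rfl, hu⟩ := coeff_rename_ne_zero _ _ _ he
    have hw : Finsupp.weight w (u.mapDomain fun k => (k, 0)) =
        Finsupp.weight (fun k => w (k, 0)) u :=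
      Finsupp.linearCombination_mapDomain ℕ _ u
    exact hw.trans_le (hg i hi u hu)
  · simp at he

theorem weight_EV {n : ℕ} [NeZero n] (w : Fin n × ℕ → ℕ) (α β : Fin n → ℕ) :
    Finsupp.weight w (EV n α β) =
      ∑ i, β i * w (i, 0) + ∑ j : Fin n, α j * w (0, (j : ℕ) + 1) := by
  simp [EV, Finsupp.weight_single]

theorem statement9 (K : Type*) [Field K] [CharZero K] (n : ℕ) [NeZero n]
    (g : Fin n → MvPolynomial (Fin n) K) (D : ℕ) (hD : 0 < D)
    (hdeg : ∀ i : Fin n, i ≠ 0 → (g i).totalDegree ≤ D)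
    (α β α' β' : Fin n → ℕ)
    (h : MvPolynomial.coeff (EV n α' β')
      (lieStar K n g (monomial (EV n α β) (1 : K))) ≠ 0) :
    ((∑ i, β' i) + ∑ j : Fin n, (((j : ℕ) + 1) * D - ((j : ℕ) + 1) + 1) * α' j ≤
      ((∑ i, β i) + ∑ j : Fin n, (((j : ℕ) + 1) * D - ((j : ℕ) + 1) + 1) * α j) + (D - 1)) ∧
    (∑ j : Fin n, ((j : ℕ) + 1) * α' j) ≤ (∑ j : Fin n, ((j : ℕ) + 1) * α j) + 1 := by
  constructor
  · have key := weight_le_of_coeff_lieStar_monomial_ne_zero g (fun v => v.2 * D - v.2 + 1) (D - 1)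
      ?_ ?_ _ _ _ h
    · simpa only [weight_EV, zero_mul, Nat.sub_zero, zero_add, mul_one, mul_comm (α _),
        mul_comm (α' _)] using key
    · intro j
      obtain ⟨d, rfl⟩ := Nat.exists_eq_add_of_le' hD
      simp only [mul_add, add_mul]
      omega
    · intro i hi u hu
      have hle := (le_totalDegree (mem_support_iff.2 hu)).trans (hdeg i hi)
      have hw : Finsupp.weight (fun _ : Fin n => 1) u = u.sum fun _ k => k := by
        simp [Finsupp.weight_apply]
      simp only [zero_mul, Nat.sub_zero, zero_add]
      omega
  · have key := weight_le_of_coeff_lieStar_monomial_ne_zero g (fun v => v.2) 1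
      (fun _ => le_rfl) ?_ _ _ _ h
    · simpa only [weight_EV, mul_zero, Finset.sum_const_zero, zero_add, mul_comm (α _),
        mul_comm (α' _)] using key
    · intro i _ u _
      simp [Finsupp.weight_apply]
end
end

section
/- Let K be a field of characteristic zero and g = (g_1, ..., g_n) ∈ K[x_1, ..., x_n]^n with d := deg g_1 > 0 and D := max_{2 ≤ i ≤ n} deg g_i > 0. Define h_1 := g_1 and h_k := 𝓛*_g(h_{k−1}) for k ≥ 2. Then for every k ≥ 1 and every monomial m(α, β) = x_1^{β_1}⋯x_n^{β_n}(x_1')^{α_1}⋯(x_1^{(n)})^{α_n} appearing with nonzero coefficient in h_k, one has ℓ_1(α, β) ≤ d + (k−1)(D−1) and ℓ_2(α) ≤ k − 1, where ℓ_1(α, β) := Σ_{i=1}^{n} β_i + Σ_{i=1}^{n} (iD − i + 1) α_i and ℓ_2(α) := Σ_{i=1}^{n} i α_i. -/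
open MvPolynomial

noncomputable section

/-- The submodule of polynomials all of whose monomials have `w`-weight at most `N`. -/
def weightLE {σ : Type*} (K : Type*) [CommRing K] (w : σ → ℕ) (N : ℕ) :
    Submodule K (MvPolynomial σ K) where
  carrier := {p | ∀ m, coeff m p ≠ 0 → Finsupp.weight w m ≤ N}
  zero_mem' := by simp
  add_mem' := by
    intro p q hp hq m hm
    by_cases h : coeff m p = 0
    · exact hq m fun h' => hm (by simp [h, h'])
    · exact hp m h
  smul_mem' := by
    intro c p hp m hm
    exact hp m fun h' => hm (by simp [h'])

section weightLE

variable {σ K : Type*} [CommRing K] {w : σ → ℕ}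

theorem mem_weightLE {N : ℕ} {p : MvPolynomial σ K} :
    p ∈ weightLE K w N ↔ ∀ m, coeff m p ≠ 0 → Finsupp.weight w m ≤ N :=
  Iff.rfl

theorem weightLE_mono {M N : ℕ} (h : M ≤ N) : weightLE K w M ≤ weightLE K w N :=
  fun _ hp m hm => (hp m hm).trans h

theorem monomial_mem_weightLE {N : ℕ} {s : σ →₀ ℕ} (hs : Finsupp.weight w s ≤ N) (r : K) :
    monomial s r ∈ weightLE K w N := by
  classical
  intro m hm
  rw [coeff_monomial] at hm
  obtain rfl : s = m := by
    by_contra h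
    exact hm (if_neg h)
  exact hs

theorem X_mem_weightLE {N : ℕ} {i : σ} (hi : w i ≤ N) :
    (X i : MvPolynomial σ K) ∈ weightLE K w N :=
  monomial_mem_weightLE (by simpa [Finsupp.weight_single] using hi) 1

theorem mul_mem_weightLE {M N : ℕ} {p q : MvPolynomial σ K} (hp : p ∈ weightLE K w M)
    (hq : q ∈ weightLE K w N) : p * q ∈ weightLE K w (M + N) := by
  classical
  intro m hm
  rw [coeff_mul] at hm
  obtain ⟨⟨a, b⟩, hab, h⟩ := Finset.exists_ne_zero_of_sum_ne_zero hm
  rw [Finset.HasAntidiagonal.mem_antidiagonal] at hab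
  rw [← hab, map_add]
  exact add_le_add (hp a (left_ne_zero_of_mul h)) (hq b (right_ne_zero_of_mul h))

/-- Renaming variables into variables of weight at most `c` bounds the weight by `c` times
the total degree. -/
theorem rename_mem_weightLE {τ : Type*} {c : ℕ} {f : τ → σ} (hf : ∀ i, w (f i) ≤ c)
    (p : MvPolynomial τ K) : rename f p ∈ weightLE K w (c * p.totalDegree) := by
  intro m hm
  obtain ⟨u, rfl, hu⟩ := coeff_rename_ne_zero _ _ _ hm
  have hdeg := le_totalDegree (mem_support_iff.mpr hu)
  calc Finsupp.weight w (u.mapDomain f) = u.sum fun i k => k * w (f i) := by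
        rw [Finsupp.weight_apply, Finsupp.sum_mapDomain_index (by simp) (by simp [add_mul])]
        simp
    _ ≤ u.sum fun _ k => c * k :=
        Finset.sum_le_sum fun i _ => (Nat.mul_le_mul_left _ (hf i)).trans_eq (mul_comm _ _)
    _ = c * u.sum fun _ k => k := by rw [Finsupp.mul_sum]
    _ ≤ c * p.totalDegree := Nat.mul_le_mul_left _ hdeg

/-- A derivation raising the weight of each variable by at most `c` raises the weight of every
polynomial by at most `c`. -/
theorem mkDerivation_mem_weightLE {f : σ → MvPolynomial σ K} {c N : ℕ}
    (hf : ∀ i, f i ∈ weightLE K w (w i + c)) {p : MvPolynomial σ K} (hp : p ∈ weightLE K w N) :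
    mkDerivation K f p ∈ weightLE K w (N + c) := by
  rw [p.as_sum, map_sum]
  refine Submodule.sum_mem _ fun s hs => ?_
  rw [mkDerivation_monomial]
  refine Submodule.smul_mem _ _ (Submodule.sum_mem _ fun i hi => ?_)
  have hle : Finsupp.single i 1 ≤ s := by
    rw [Finsupp.single_le_iff]
    exact Nat.one_le_iff_ne_zero.mpr (Finsupp.mem_support_iff.mp hi)
  have hw : Finsupp.weight w (s - Finsupp.single i 1) + w i = Finsupp.weight w s := by
    conv_rhs => rw [← tsub_add_cancel_of_le hle, map_add, Finsupp.weight_single, one_smul]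
  have hN := hp s (mem_support_iff.mp hs)
  exact weightLE_mono (by omega) (mul_mem_weightLE (monomial_mem_weightLE le_rfl _) (hf i))

theorem iterate_mkDerivation_mem_weightLE {f : σ → MvPolynomial σ K} {c N : ℕ}
    (hf : ∀ i, f i ∈ weightLE K w (w i + c)) {p : MvPolynomial σ K} (hp : p ∈ weightLE K w N)
    (k : ℕ) : (⇑(mkDerivation K f))^[k] p ∈ weightLE K w (N + k * c) := by
  induction k with
  | zero => simpa using hp
  | succ k ih =>
    rw [Function.iterate_succ_apply']
    exact weightLE_mono (by rw [add_mul, one_mul, add_assoc]) (mkDerivation_mem_weightLE hf ih)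

end weightLE

theorem statement10 (K : Type*) [Field K] [CharZero K] (n : ℕ) [NeZero n]
    (g : Fin n → MvPolynomial (Fin n) K) (d D : ℕ)
    (hd : d = (g 0).totalDegree) (hd0 : 0 < d)
    (hD : D = (Finset.univ.filter fun i : Fin n => i ≠ 0).sup fun i => (g i).totalDegree)
    (hD0 : 0 < D)
    (k : ℕ) (hk : 1 ≤ k) (α β : Fin n → ℕ)
    (h : MvPolynomial.coeff (EV n α β)
      ((⇑(lieStar K n g))^[k - 1] (rename (fun j => (j, 0)) (g 0))) ≠ 0) :
    ((∑ i, β i) + ∑ j : Fin n, (((j : ℕ) + 1) * D - ((j : ℕ) + 1) + 1) * α j ≤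
      d + (k - 1) * (D - 1)) ∧
    (∑ j : Fin n, ((j : ℕ) + 1) * α j) ≤ k - 1 := by
  constructor
  · have hmem := iterate_mkDerivation_mem_weightLE (w := fun v : Fin n × ℕ => v.2 * (D - 1) + 1)
      (f := fun v => if v.1 = 0 then X (v.1, v.2 + 1)
        else if v.2 = 0 then rename (fun j => (j, 0)) (g v.1) else 0) (c := D - 1) ?_
      (rename_mem_weightLE (c := 1) (by simp) (g 0)) (k - 1) _ h
    · rw [weight_EV, one_mul, ← hd] at hmem
      refine le_trans (le_of_eq ?_) hmem
      congr 1
      · simp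
      · refine Finset.sum_congr rfl fun j _ => ?_
        rw [mul_comm, Nat.mul_sub, mul_one]
    · rintro ⟨i, j⟩
      dsimp only
      split_ifs with hi hj
      · exact X_mem_weightLE (le_of_eq (by ring))
      · have hg : (g i).totalDegree ≤ D := by
          rw [hD]
          exact Finset.le_sup (f := fun i => (g i).totalDegree) (by simpa using hi)
        exact weightLE_mono (by subst hj; omega) (rename_mem_weightLE (c := 1) (by simp) (g i))
      · exact Submodule.zero_mem _
  · have hmem := iterate_mkDerivation_mem_weightLE (w := fun v : Fin n × ℕ => v.2)
      (f := fun v => if v.1 = 0 then X (v.1, v.2 + 1)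
        else if v.2 = 0 then rename (fun j => (j, 0)) (g v.1) else 0) (c := 1) ?_
      (rename_mem_weightLE (c := 0) (by simp) (g 0)) (k - 1) _ h
    · rw [weight_EV] at hmem
      simpa [mul_comm] using hmem
    · rintro ⟨i, j⟩
      dsimp only
      split_ifs with hi hj
      · exact X_mem_weightLE le_rfl
      · exact weightLE_mono (by simp) (rename_mem_weightLE (c := 0) (by simp) (g i))
      · exact Submodule.zero_mem _
end
end
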